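/- (Embedding of X_V into Musielak–Orlicz Lebesgue spaces under condition (O).) Assume condition (O) and let r, s : ℝ^N → ℝ be continuous and bounded with p(x) ≤ r(x) ≤ p*(x) and q(x) ≤ s(x) ≤ q*(x) for all x. Set F(x,t) := t^{r(x)} + a(x)^{s(x)/q(x)} t^{s(x)}. Then there exists C > 0 such that for every u ∈ C_c^∞(ℝ^N): ‖u‖_{L^F(ℝ^N)} ≤ C ‖u‖, where ‖u‖ := inf{τ > 0 : ρ_V(u/τ) ≤ 1}. -/

import Mathlib

open MeasureTheory Filter
open scoped ENNReal

/-- The double phase integrand `H(x,t) = t^{p(x)} + a(x) t^{q(x)}`. -/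
noncomputable def Hfun {N : ℕ} (p q a : EuclideanSpace ℝ (Fin N) → ℝ)
    (x : EuclideanSpace ℝ (Fin N)) (t : ℝ) : ℝ :=
  t ^ p x + a x * t ^ q x

/-- The modular `ρ_V(u) = ∫_{ℝ^N} [H(x,|∇u|) + V(x) H(x,|u|)] dx`. -/
noncomputable def rhoV {N : ℕ} (p q a V : EuclideanSpace ℝ (Fin N) → ℝ)
    (u : EuclideanSpace ℝ (Fin N) → ℝ) : ℝ≥0∞ :=
  ∫⁻ x, (ENNReal.ofReal (Hfun p q a x ‖gradient u x‖) +
    ENNReal.ofReal (V x * Hfun p q a x |u x|))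

/-- The Luxemburg norm `‖u‖ = inf {τ > 0 : ρ_V(u/τ) ≤ 1}` associated with `ρ_V`. -/
noncomputable def VNorm {N : ℕ} (p q a V : EuclideanSpace ℝ (Fin N) → ℝ)
    (u : EuclideanSpace ℝ (Fin N) → ℝ) : ℝ :=
  sInf {τ : ℝ | 0 < τ ∧
    (∫⁻ x, (ENNReal.ofReal (Hfun p q a x (‖gradient u x‖ / τ)) +
      ENNReal.ofReal (V x * Hfun p q a x (|u x| / τ)))) ≤ 1}

/-- The Luxemburg norm `‖u‖_{L^Φ(U)}` of a Musielak integrand `Φ` on a set `U`. -/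
noncomputable def luxNormOn {N : ℕ} (Φ : EuclideanSpace ℝ (Fin N) → ℝ → ℝ)
    (U : Set (EuclideanSpace ℝ (Fin N))) (u : EuclideanSpace ℝ (Fin N) → ℝ) : ℝ :=
  sInf {τ : ℝ | 0 < τ ∧ (∫⁻ x in U, ENNReal.ofReal (Φ x (|u x| / τ))) ≤ 1}

/-- The Sobolev Luxemburg norm `‖u‖_{W^{1,H}(U)}`. -/
noncomputable def sobNormOn {N : ℕ} (p q a : EuclideanSpace ℝ (Fin N) → ℝ)
    (U : Set (EuclideanSpace ℝ (Fin N))) (u : EuclideanSpace ℝ (Fin N) → ℝ) : ℝ :=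
  sInf {τ : ℝ | 0 < τ ∧
    (∫⁻ x in U, (ENNReal.ofReal (Hfun p q a x (‖gradient u x‖ / τ)) +
      ENNReal.ofReal (Hfun p q a x (|u x| / τ)))) ≤ 1}

/-- The open cube `Q_{y,ε}` centered at `y` with edges parallel to the axes of length `ε`. -/
def cube {N : ℕ} (y : EuclideanSpace ℝ (Fin N)) (ε : ℝ) : Set (EuclideanSpace ℝ (Fin N)) :=
  {x | ∀ i, |x i - y i| < ε / 2}

/-- Condition (D): `p, q` bounded Lipschitz with `1 < inf p`, `sup q < N`,
`p < q < N` pointwise, `sup q/p < 1 + 1/N`; `a ≥ 0` bounded Lipschitz. -/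
structure CondD (N : ℕ) (p q a : EuclideanSpace ℝ (Fin N) → ℝ) : Prop where
  lip_p : ∃ K : NNReal, LipschitzWith K p
  lip_q : ∃ K : NNReal, LipschitzWith K q
  lip_a : ∃ K : NNReal, LipschitzWith K a
  inf_p : ∃ c > (1 : ℝ), ∀ x, c ≤ p x
  sup_q : ∃ c < (N : ℝ), ∀ x, q x ≤ c
  p_lt_q : ∀ x, p x < q x
  q_lt_N : ∀ x, q x < N
  ratio : ∃ c < 1 + 1 / (N : ℝ), ∀ x, q x / p x ≤ c
  a_nonneg : ∀ x, 0 ≤ a x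
  a_bdd : ∃ C : ℝ, ∀ x, a x ≤ C

/-- Condition (O): condition (D) together with `V ∈ L¹_loc`, `V ≥ 0` a.e., one of the
two structural alternatives on the potential, and the log-Hölder-type decay of `p`
towards `p_∞` when `ess inf V = 0`. -/
structure CondO (N : ℕ) (p q a V : EuclideanSpace ℝ (Fin N) → ℝ)
    extends CondD N p q a : Prop where
  V_loc : LocallyIntegrable V volume
  V_nonneg : ∀ᵐ x ∂(volume : Measure (EuclideanSpace ℝ (Fin N))), 0 ≤ V x
  V_alt : (∃ K₀ > (0 : ℝ), {x | V x ≤ K₀}.Nonempty ∧ volume {x | V x ≤ K₀} < ⊤) ∨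
    (∃ R > (0 : ℝ),
      0 < essInf V (volume.restrict {x : EuclideanSpace ℝ (Fin N) | R ≤ ‖x‖}))
  V_log : essInf V (volume : Measure (EuclideanSpace ℝ (Fin N))) = 0 →
    ∃ pinf : ℝ, 1 < pinf ∧ pinf < N ∧
      ∃ C : ℝ, ∀ x, |p x - pinf| * Real.log (Real.exp 1 + ‖x‖) ≤ C

open scoped Convolution in
/-- A bounded Lipschitz function is a pointwise limit of smooth functions satisfying the same
bounds and the same Lipschitz estimate. -/
theorem exists_smooth_approx {N : ℕ} {f : EuclideanSpace ℝ (Fin N) → ℝ} {K : NNReal}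
    (hf : LipschitzWith K f) {m M : ℝ} (hm : ∀ x, m ≤ f x) (hM : ∀ x, f x ≤ M) :
    ∃ F : ℕ → EuclideanSpace ℝ (Fin N) → ℝ, (∀ n, ContDiff ℝ 1 (F n)) ∧
      (∀ n x, ‖fderiv ℝ (F n) x‖ ≤ K) ∧ (∀ n x, m ≤ F n x) ∧ (∀ n x, F n x ≤ M) ∧
      ∀ x, Tendsto (fun n => F n x) atTop (nhds (f x)) := by
  let φ : ℕ → ContDiffBump (0 : EuclideanSpace ℝ (Fin N)) := fun n =>
    ⟨1 / (2 * ((n : ℝ) + 1)), 1 / ((n : ℝ) + 1), by positivity, by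
      apply one_div_lt_one_div_of_lt (by positivity)
      have : (0 : ℝ) ≤ n := Nat.cast_nonneg n
      linarith⟩
  have hφ : Tendsto (fun n => (φ n).rOut) atTop (nhds 0) :=
    tendsto_one_div_add_atTop_nhds_zero_nat
  have hintg : ∀ n x, Integrable
      (fun t => (φ n).normed volume t * f (x - t)) volume := fun n x =>
    (((φ n).continuous_normed).mul
      (hf.continuous.comp (continuous_const.sub continuous_id))).integrable_of_hasCompactSupport
      ((φ n).hasCompactSupport_normed.mul_right)
  have hφint : ∀ n, Integrable ((φ n).normed (volume : Measure (EuclideanSpace ℝ (Fin N))))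
      volume := fun n => (φ n).integrable_normed
  have hconst : ∀ n (c : ℝ), ∫ t, (φ n).normed volume t * c = c := fun n c => by
    rw [integral_mul_const, (φ n).integral_normed, one_mul]
  have hval : ∀ n x, ((φ n).normed volume ⋆[ContinuousLinearMap.lsmul ℝ ℝ, volume] f) x
      = ∫ t, (φ n).normed volume t * f (x - t) := fun n x => by
    simp [convolution_def]
  refine ⟨fun n => ((φ n).normed volume ⋆[ContinuousLinearMap.lsmul ℝ ℝ, volume] f), ?_, ?_, ?_,
    ?_, ?_⟩
  · intro n
    exact (φ n).hasCompactSupport_normed.contDiff_convolution_left _ (φ n).contDiff_normed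
      hf.continuous.locallyIntegrable
  · intro n x
    refine norm_fderiv_le_of_lipschitz ℝ (LipschitzWith.of_dist_le_mul fun y z => ?_)
    beta_reduce
    rw [hval, hval, Real.dist_eq, ← integral_sub (hintg n y) (hintg n z), ← Real.norm_eq_abs]
    calc _ ≤ ∫ t, (φ n).normed volume t * (K * dist y z) := by
          refine norm_integral_le_of_norm_le ((hφint n).mul_const _)
            (Eventually.of_forall fun t => ?_)
          rw [← mul_sub, norm_mul, Real.norm_of_nonneg ((φ n).nonneg_normed t)]
          gcongr
          · exact (φ n).nonneg_normed t
          · have := hf.dist_le_mul (y - t) (z - t)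
            rwa [dist_sub_right, Real.dist_eq, ← Real.norm_eq_abs] at this
      _ = _ := hconst n _
  · intro n x
    beta_reduce
    rw [hval, ← hconst n m]
    exact integral_mono ((hφint n).mul_const _) (hintg n x) fun t =>
      mul_le_mul_of_nonneg_left (hm _) ((φ n).nonneg_normed t)
  · intro n x
    beta_reduce
    rw [hval, ← hconst n M]
    exact integral_mono (hintg n x) ((hφint n).mul_const _) fun t =>
      mul_le_mul_of_nonneg_left (hM _) ((φ n).nonneg_normed t)
  · intro x
    exact ContDiffBump.convolution_tendsto_right_of_continuous hφ hf.continuous x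

/-- A smooth cutoff vanishing on `[-1, 1]` and equal to one outside `(-2, 2)`. -/
noncomputable def levelCutoff (t : ℝ) : ℝ := Real.smoothTransition (t ^ 2 - 1)

theorem contDiff_levelCutoff : ContDiff ℝ 1 levelCutoff :=
  (Real.smoothTransition.contDiff (n := 1)).comp (by fun_prop)

theorem levelCutoff_nonneg (t : ℝ) : 0 ≤ levelCutoff t := Real.smoothTransition.nonneg _

theorem levelCutoff_le_one (t : ℝ) : levelCutoff t ≤ 1 := Real.smoothTransition.le_one _

theorem levelCutoff_eq_zero {t : ℝ} (ht : |t| ≤ 1) : levelCutoff t = 0 := by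
  apply Real.smoothTransition.zero_of_nonpos
  have := (sq_le_one_iff_abs_le_one t).2 ht
  linarith

theorem levelCutoff_eq_one {t : ℝ} (ht : 2 ≤ |t|) : levelCutoff t = 1 := by
  apply Real.smoothTransition.one_of_one_le
  have : (2:ℝ) ^ 2 ≤ |t| ^ 2 := by gcongr
  rw [sq_abs] at this
  linarith

theorem deriv_levelCutoff_eq_zero_of_lt_one {t : ℝ} (ht : |t| < 1) : deriv levelCutoff t = 0 := by
  have : levelCutoff =ᶠ[nhds t] fun _ => 0 := by
    filter_upwards [(continuous_abs.isOpen_preimage _ isOpen_Iio).mem_nhds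
      (show t ∈ abs ⁻¹' Set.Iio (1:ℝ) from ht)] with s hs
    exact levelCutoff_eq_zero (le_of_lt hs)
  rw [this.deriv_eq, deriv_const]

theorem deriv_levelCutoff_eq_zero_of_two_lt {t : ℝ} (ht : 2 < |t|) : deriv levelCutoff t = 0 := by
  have : levelCutoff =ᶠ[nhds t] fun _ => 1 := by
    filter_upwards [(continuous_abs.isOpen_preimage _ isOpen_Ioi).mem_nhds
      (show t ∈ abs ⁻¹' Set.Ioi (2:ℝ) from ht)] with s hs
    exact levelCutoff_eq_one (le_of_lt hs)
  rw [this.deriv_eq, deriv_const]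

theorem exists_abs_deriv_levelCutoff_le :
    ∃ C : ℝ, 0 ≤ C ∧ ∀ t, |deriv levelCutoff t| ≤ C / Real.sqrt (1 + t ^ 2) := by
  have hc : Continuous fun t => |deriv levelCutoff t| * Real.sqrt (1 + t ^ 2) :=
    ((contDiff_levelCutoff.continuous_deriv le_rfl).abs).mul (by fun_prop)
  obtain ⟨C, hC⟩ := (isCompact_Icc (a := (-2:ℝ)) (b := 2)).bddAbove_image hc.continuousOn
  refine ⟨max C 0, le_max_right _ _, fun t => ?_⟩
  have hp : 0 < Real.sqrt (1 + t ^ 2) := Real.sqrt_pos.2 (by positivity)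
  rw [le_div_iff₀ hp]
  by_cases ht : 2 < |t|
  · rw [deriv_levelCutoff_eq_zero_of_two_lt ht]; simp
  · push Not at ht
    exact (hC ⟨t, abs_le.1 ht, rfl⟩).trans (le_max_left _ _)

/-- The smooth bracket `√(1 + t²)`. -/
noncomputable def bracket (t : ℝ) : ℝ := Real.sqrt (1 + t ^ 2)

theorem one_le_bracket (t : ℝ) : 1 ≤ bracket t :=
  Real.one_le_sqrt.2 (by nlinarith [sq_nonneg t])

theorem bracket_pos (t : ℝ) : 0 < bracket t := one_pos.trans_le (one_le_bracket t)

theorem abs_le_bracket (t : ℝ) : |t| ≤ bracket t := Real.abs_le_sqrt (by linarith)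

theorem sq_bracket (t : ℝ) : bracket t ^ 2 = 1 + t ^ 2 := Real.sq_sqrt (by positivity)

theorem log_bracket (t : ℝ) : Real.log (bracket t) = Real.log (1 + t ^ 2) / 2 :=
  Real.log_sqrt (by positivity)

theorem log_bracket_nonneg (t : ℝ) : 0 ≤ Real.log (bracket t) :=
  Real.log_nonneg (one_le_bracket t)

theorem continuous_bracket : Continuous bracket := by unfold bracket; fun_prop

theorem hasDerivAt_log_bracket (t : ℝ) :
    HasDerivAt (fun t => Real.log (bracket t)) (t / (1 + t ^ 2)) t := by
  simp_rw [log_bracket]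
  have h : HasDerivAt (fun t : ℝ => 1 + t ^ 2) (2 * t) t := by
    simpa using (hasDerivAt_pow 2 t).const_add 1
  refine ((h.log (by positivity)).div_const 2).congr_deriv ?_
  ring

theorem abs_div_le_inv_bracket (t : ℝ) : |t / (1 + t ^ 2)| ≤ (bracket t)⁻¹ := by
  rw [abs_div, abs_of_pos (show 0 < 1 + t ^ 2 by positivity), ← sq_bracket,
    div_le_iff₀ (pow_pos (bracket_pos t) 2)]
  have := bracket_pos t
  field_simp
  exact abs_le_bracket t

theorem mul_abs_log_le {α A : ℝ} (h0 : 0 < α) (hA : α ≤ A) : α * |Real.log α| ≤ 1 + A ^ 2 := by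
  have h1 : Real.log α ≤ α := (Real.log_le_sub_one_of_pos h0).trans (by linarith)
  have h2 : -Real.log α ≤ α⁻¹ := by
    rw [← Real.log_inv]
    exact (Real.log_le_sub_one_of_pos (inv_pos.2 h0)).trans (by linarith)
  rcases abs_cases (Real.log α) with ⟨h, _⟩ | ⟨h, _⟩ <;> rw [h]
  · nlinarith
  · have := mul_le_mul_of_nonneg_left h2 h0.le
    rw [mul_inv_cancel₀ h0.ne'] at this
    nlinarith [sq_nonneg A]

/-- The truncated function to which the Gagliardo-Nirenberg-Sobolev inequality is applied. -/
noncomputable def sobLhs {N : ℕ} (u α θ : EuclideanSpace ℝ (Fin N) → ℝ)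
    (x : EuclideanSpace ℝ (Fin N)) : ℝ :=
  levelCutoff (u x) * (α x ^ θ x * bracket (u x) ^ (N * θ x - (N - 1)))

/-- The majorant of the gradient of `sobLhs`. -/
noncomputable def sobRhs {N : ℕ} (u α θ : EuclideanSpace ℝ (Fin N) → ℝ)
    (x : EuclideanSpace ℝ (Fin N)) : ℝ :=
  α x ^ θ x * bracket (u x) ^ (N * θ x - N) * ‖fderiv ℝ u x‖ +
    α x ^ θ x * bracket (u x) ^ (N * θ x - (N - 1)) * Real.log (bracket (u x)) +
    α x ^ (θ x - 1) * bracket (u x) ^ (N * θ x - (N - 1))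

theorem sobLhs_eq_exp {N : ℕ} {u α θ : EuclideanSpace ℝ (Fin N) → ℝ} (hα : ∀ x, 0 < α x) :
    sobLhs u α θ = fun x => levelCutoff (u x) * Real.exp (θ x * Real.log (α x) +
      (N * θ x - (N - 1)) * Real.log (bracket (u x))) := by
  ext x
  rw [sobLhs, Real.rpow_def_of_pos (hα x), Real.rpow_def_of_pos (bracket_pos _), Real.exp_add,
    mul_comm (θ x), mul_comm (N * θ x - (N - 1)) (Real.log _)]

theorem contDiff_sobLhs {N : ℕ} {u α θ : EuclideanSpace ℝ (Fin N) → ℝ} (hu : ContDiff ℝ 1 u)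
    (hα : ContDiff ℝ 1 α) (hθ : ContDiff ℝ 1 θ) (hpos : ∀ x, 0 < α x) :
    ContDiff ℝ 1 (sobLhs u α θ) := by
  rw [sobLhs_eq_exp hpos]
  simp_rw [log_bracket]
  refine (contDiff_levelCutoff.comp hu).mul (ContDiff.exp (ContDiff.add
    (hθ.mul (hα.log fun x => (hpos x).ne')) (ContDiff.mul (by fun_prop) (ContDiff.div_const
      (ContDiff.log (by fun_prop) fun x => ?_) _))))
  positivity

theorem norm_fderiv_sobLhs_le {N : ℕ} {u α θ : EuclideanSpace ℝ (Fin N) → ℝ}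
    (hu : ContDiff ℝ 1 u) (hα : ContDiff ℝ 1 α) (hθ : ContDiff ℝ 1 θ) {A L Θ C : ℝ}
    (hN : 1 ≤ N)
    (hpos : ∀ x, 0 < α x) (hA : ∀ x, α x ≤ A) (hθ1 : ∀ x, 1 ≤ θ x) (hΘ : ∀ x, θ x ≤ Θ)
    (hLα : ∀ x, ‖fderiv ℝ α x‖ ≤ L) (hLθ : ∀ x, ‖fderiv ℝ θ x‖ ≤ L) (hC0 : 0 ≤ C)
    (hC : ∀ t, |deriv levelCutoff t| ≤ C / Real.sqrt (1 + t ^ 2)) (x) :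
    ‖fderiv ℝ (sobLhs u α θ) x‖ ≤ Set.indicator {x | 1 ≤ |u x|}
      (fun x => (C + N * Θ + N * L + L * (Θ + 1 + A ^ 2)) * sobRhs u α θ x) x := by
  have hdu : HasFDerivAt u (fderiv ℝ u x) x := (hu.differentiable one_ne_zero x).hasFDerivAt
  have hdα : HasFDerivAt α (fderiv ℝ α x) x := (hα.differentiable one_ne_zero x).hasFDerivAt
  have hdθ : HasFDerivAt θ (fderiv ℝ θ x) x := (hθ.differentiable one_ne_zero x).hasFDerivAt
  have hη : HasDerivAt levelCutoff (deriv levelCutoff (u x)) (u x) :=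
    (contDiff_levelCutoff.differentiable one_ne_zero _).hasDerivAt
  have he := (hdθ.mul (hdα.log (hpos x).ne')).add
    (((hdθ.const_mul (N : ℝ)).sub_const ((N : ℝ) - 1)).mul
      ((hasDerivAt_log_bracket (u x)).comp_hasFDerivAt x hdu))
  have hw := (hη.comp_hasFDerivAt x hdu).mul he.exp
  have hw' := hw.congr_of_eventuallyEq (f₁ := sobLhs u α θ)
    (Eventually.of_forall fun y => by rw [sobLhs_eq_exp hpos]; rfl)
  rw [hw'.fderiv]
  clear hw hw' he
  by_cases hx : 1 ≤ |u x|
  · rw [Set.indicator_of_mem (by exact hx)]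
    have hL : 0 ≤ L := (norm_nonneg _).trans (hLα x)
    have hg := bracket_pos (u x)
    have hex : Real.exp (θ x * Real.log (α x) +
        (N * θ x - (N - 1)) * Real.log (bracket (u x))) =
        α x ^ θ x * bracket (u x) ^ (N * θ x - (N - 1)) := by
      rw [Real.rpow_def_of_pos (hpos x), Real.rpow_def_of_pos hg, Real.exp_add,
        mul_comm (θ x), mul_comm (N * θ x - (N - 1)) (Real.log _)]
    simp only [Function.comp_apply, hex, Pi.add_apply, Pi.mul_apply]
    have hA' := hA x
    have hα0 := hpos x
    have hN' : (1 : ℝ) ≤ N := by exact_mod_cast hN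
    have hθx := hθ1 x
    have hΘx := hΘ x
    rw [sobRhs, Real.rpow_sub_one hα0.ne',
      show (N * θ x - N : ℝ) = N * θ x - (N - 1) - 1 by ring, Real.rpow_sub_one hg.ne']
    have hP : 0 < α x ^ θ x := Real.rpow_pos_of_pos hα0 _
    have hG : 0 < bracket (u x) ^ (N * θ x - (N - 1)) := Real.rpow_pos_of_pos hg _
    have hσ0 : 0 ≤ N * θ x - (N - 1) := by nlinarith
    have hσ : N * θ x - (N - 1) ≤ N * Θ := by nlinarith
    have hlog : |Real.log (α x)| ≤ (1 + A ^ 2) * (α x)⁻¹ := by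
      rw [← div_eq_mul_inv, le_div_iff₀ hα0, mul_comm]
      exact mul_abs_log_le hα0 hA'
    have hfrac := abs_div_le_inv_bracket (u x)
    have hη' : |deriv levelCutoff (u x)| ≤ C * (bracket (u x))⁻¹ := hC (u x)
    have hℓ := log_bracket_nonneg (u x)
    have hΘ0 : 0 ≤ Θ := by linarith
    rw [div_eq_mul_inv (α x ^ θ x), div_eq_mul_inv _ (bracket (u x))]
    have hgi : 0 < (bracket (u x))⁻¹ := inv_pos.2 hg
    have hαi : 0 < (α x)⁻¹ := inv_pos.2 hα0
    generalize hPd : α x ^ θ x = P at *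
    generalize hGd : bracket (u x) ^ (N * θ x - (N - 1)) = G at *
    generalize Real.log (bracket (u x)) = ℓ at *
    generalize (bracket (u x))⁻¹ = gi at *
    generalize (α x)⁻¹ = αi at *
    have hd := norm_nonneg (fderiv ℝ u x)
    calc _ ≤ 1 * (P * G * (Θ * (αi * L) + (1 + A ^ 2) * αi * L +
            (N * Θ * (gi * ‖fderiv ℝ u x‖) + ℓ * (N * L)))) +
            P * G * (C * gi * ‖fderiv ℝ u x‖) := by
          refine (norm_add_le _ _).trans (add_le_add ?_ ?_)
          · rw [norm_smul, norm_smul, Real.norm_of_nonneg (levelCutoff_nonneg _),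
              Real.norm_of_nonneg (mul_pos hP hG).le]
            gcongr
            · exact levelCutoff_le_one _
            · refine (norm_add_le _ _).trans (add_le_add ((norm_add_le _ _).trans
                (add_le_add ?_ ?_)) ((norm_add_le _ _).trans (add_le_add ?_ ?_)))
              · rw [norm_smul, norm_smul, Real.norm_of_nonneg (by linarith : 0 ≤ θ x),
                  Real.norm_of_nonneg hαi.le]
                gcongr
                exact hLα x
              · rw [norm_smul, Real.norm_eq_abs]
                gcongr
                exact hLθ x
              · rw [norm_smul, norm_smul, Real.norm_of_nonneg hσ0, Real.norm_eq_abs]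
                gcongr
              · rw [norm_smul, norm_smul, Real.norm_of_nonneg hℓ,
                  Real.norm_of_nonneg (by linarith : (0 : ℝ) ≤ N)]
                gcongr
                exact hLθ x
          · rw [norm_smul, norm_smul, Real.norm_of_nonneg (mul_pos hP hG).le, Real.norm_eq_abs]
            gcongr
      _ ≤ _ := by
          have h1 : 0 ≤ P * G * gi * ‖fderiv ℝ u x‖ := by positivity
          have h2 : 0 ≤ P * G * ℓ := by positivity
          have h3 : 0 ≤ P * G * αi := by positivity
          have k1 : 0 ≤ (N : ℝ) * Θ := by positivity
          have k2 : 0 ≤ N * L := by positivity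
          have k3 : 0 ≤ L * (Θ + 1 + A ^ 2) := by positivity
          nlinarith [mul_nonneg h1 k2, mul_nonneg h1 k3, mul_nonneg h2 hC0, mul_nonneg h2 k1,
            mul_nonneg h2 k3, mul_nonneg h3 hC0, mul_nonneg h3 k1, mul_nonneg h3 k2]
  · rw [Set.indicator_of_notMem (by exact hx)]
    push Not at hx
    simp [levelCutoff_eq_zero hx.le, deriv_levelCutoff_eq_zero_of_lt_one hx]

theorem sobLhs_nonneg {N : ℕ} {u α θ : EuclideanSpace ℝ (Fin N) → ℝ} {x} (hα : 0 ≤ α x) :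
    0 ≤ sobLhs u α θ x :=
  mul_nonneg (levelCutoff_nonneg _)
    (mul_nonneg (Real.rpow_nonneg hα _) (Real.rpow_nonneg (bracket_pos _).le _))

theorem sobRhs_nonneg {N : ℕ} {u α θ : EuclideanSpace ℝ (Fin N) → ℝ} {x} (hα : 0 ≤ α x) :
    0 ≤ sobRhs u α θ x := by
  have h1 := fun e => Real.rpow_nonneg (bracket_pos (u x)).le e
  have h2 := fun e => Real.rpow_nonneg hα e
  have h3 := log_bracket_nonneg (u x)
  exact add_nonneg (add_nonneg (mul_nonneg (mul_nonneg (h2 _) (h1 _)) (norm_nonneg _))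
    (mul_nonneg (mul_nonneg (h2 _) (h1 _)) h3)) (mul_nonneg (h2 _) (h1 _))

theorem isCompact_superlevel {N : ℕ} {u : EuclideanSpace ℝ (Fin N) → ℝ} (hu : Continuous u)
    (hc : HasCompactSupport u) : IsCompact {x | 1 ≤ |u x|} := by
  refine IsCompact.of_isClosed_subset hc (isClosed_le continuous_const hu.abs) fun x hx => ?_
  refine subset_tsupport u fun h => ?_
  simp only [Set.mem_ofPred_eq, h, abs_zero] at hx
  linarith

theorem continuous_sobLhs {N : ℕ} {u α θ : EuclideanSpace ℝ (Fin N) → ℝ} (hu : Continuous u)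
    (hα : Continuous α) (hθ : Continuous θ) (hθ1 : ∀ x, 0 < θ x) :
    Continuous (sobLhs u α θ) := by
  refine (contDiff_levelCutoff.continuous.comp hu).mul
    ((hα.rpow hθ fun x => Or.inr (hθ1 x)).mul
    ((continuous_bracket.comp hu).rpow (by fun_prop) fun x => Or.inl (bracket_pos _).ne'))

theorem continuous_sobRhs {N : ℕ} {u α θ : EuclideanSpace ℝ (Fin N) → ℝ} (hu : ContDiff ℝ 1 u)
    (hα : Continuous α) (hθ : Continuous θ) (hθ1 : ∀ x, 0 < θ x)
    (hαθ : ∀ x, α x ≠ 0 ∨ 1 < θ x) : Continuous (sobRhs u α θ) := by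
  have hb : ∀ e : EuclideanSpace ℝ (Fin N) → ℝ, Continuous e →
      Continuous fun x => bracket (u x) ^ e x := fun e he =>
    (continuous_bracket.comp hu.continuous).rpow he fun x => Or.inl (bracket_pos _).ne'
  have hA := hα.rpow hθ fun x => Or.inr (hθ1 x)
  have hA' := hα.rpow (hθ.sub continuous_const) fun x =>
    (hαθ x).imp id fun h => sub_pos.2 h
  have hl : Continuous fun x => Real.log (bracket (u x)) :=
    (continuous_bracket.comp hu.continuous).log fun x => (bracket_pos _).ne'
  have hd : Continuous fun x => ‖fderiv ℝ u x‖ := (hu.continuous_fderiv one_ne_zero).norm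
  exact (((hA.mul (hb _ (by fun_prop))).mul hd).add ((hA.mul (hb _ (by fun_prop))).mul hl)).add
    (hA'.mul (hb _ (by fun_prop)))

/-- Gagliardo-Nirenberg-Sobolev inequality in terms of Bochner integrals. -/
theorem integral_rpow_le_of_norm_fderiv_le {N : ℕ} (hN : 2 ≤ N)
    {w h : EuclideanSpace ℝ (Fin N) → ℝ} (hw : ContDiff ℝ 1 w) (hwc : HasCompactSupport w)
    (hw0 : ∀ x, 0 ≤ w x) {S : Set (EuclideanSpace ℝ (Fin N))} (hS : IsCompact S)
    (hh : Continuous h) (hh0 : ∀ x, 0 ≤ h x) (hle : ∀ x, ‖fderiv ℝ w x‖ ≤ S.indicator h x) :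
    ∫ x in S, w x ^ ((N : ℝ) / (N - 1)) ≤
      lintegralPowLePowLIntegralFDerivConst
        (volume : Measure (EuclideanSpace ℝ (Fin N))) ((N : ℝ) / (N - 1)) *
      (∫ x in S, h x) ^ ((N : ℝ) / (N - 1)) := by
  have hN' : (2 : ℝ) ≤ N := by exact_mod_cast hN
  set p : ℝ := (N : ℝ) / (N - 1) with hp
  have hp0 : 0 < p := div_pos (by linarith) (by linarith)
  have hconj : Real.HolderConjugate (Module.finrank ℝ (EuclideanSpace ℝ (Fin N))) p := by
    rw [finrank_euclideanSpace_fin, Real.holderConjugate_iff]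
    refine ⟨by linarith, ?_⟩
    rw [hp]; field_simp; ring
  have key := lintegral_pow_le_pow_lintegral_fderiv
    (volume : Measure (EuclideanSpace ℝ (Fin N))) hw hwc hconj
  have hintg : IntegrableOn h S := hh.continuousOn.integrableOn_compact hS
  have h1 : ENNReal.ofReal (∫ x in S, w x ^ p) ≤ ∫⁻ x, ‖w x‖ₑ ^ p := by
    rw [ofReal_integral_eq_lintegral_ofReal
      ((hw.continuous.rpow_const fun x => Or.inr hp0.le).continuousOn.integrableOn_compact hS)
      (Eventually.of_forall fun x => Real.rpow_nonneg (hw0 x) _)]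
    refine (setLIntegral_le_lintegral _ _).trans (lintegral_mono fun x => ?_)
    rw [Real.enorm_of_nonneg (hw0 x), ENNReal.ofReal_rpow_of_nonneg (hw0 x) hp0.le]
  have h2 : ∫⁻ x, ‖fderiv ℝ w x‖ₑ ≤ ENNReal.ofReal (∫ x in S, h x) := by
    rw [ofReal_integral_eq_lintegral_ofReal hintg (Eventually.of_forall hh0),
      ← lintegral_indicator hS.measurableSet]
    refine lintegral_mono fun x => ?_
    rw [← ofReal_norm]
    refine (ENNReal.ofReal_le_ofReal (hle x)).trans (le_of_eq ?_)
    by_cases hx : x ∈ S <;> simp [hx]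
  have hI : 0 ≤ ∫ x in S, h x := integral_nonneg hh0
  have h3 := h1.trans (key.trans (mul_le_mul_right (ENNReal.rpow_le_rpow h2 hp0.le) _))
  rw [ENNReal.ofReal_rpow_of_nonneg hI hp0.le, ← ENNReal.ofReal_coe_nnreal,
    ← ENNReal.ofReal_mul (NNReal.coe_nonneg _)] at h3
  exact (ENNReal.ofReal_le_ofReal_iff (by positivity)).1 h3

theorem integral_sobLhs_le_of_contDiff {N : ℕ} (hN : 2 ≤ N) {A L Θ : ℝ} :
    ∃ C : ℝ, 0 ≤ C ∧ ∀ α θ : EuclideanSpace ℝ (Fin N) → ℝ, ContDiff ℝ 1 α → ContDiff ℝ 1 θ →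
      (∀ x, 0 < α x) → (∀ x, α x ≤ A) → (∀ x, 1 ≤ θ x) → (∀ x, θ x ≤ Θ) →
      (∀ x, ‖fderiv ℝ α x‖ ≤ L) → (∀ x, ‖fderiv ℝ θ x‖ ≤ L) →
      ∀ u : EuclideanSpace ℝ (Fin N) → ℝ, ContDiff ℝ 1 u → HasCompactSupport u →
      ∫ x in {x | 1 ≤ |u x|}, sobLhs u α θ x ^ ((N : ℝ) / (N - 1)) ≤
        C * (∫ x in {x | 1 ≤ |u x|}, sobRhs u α θ x) ^ ((N : ℝ) / (N - 1)) := by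
  obtain ⟨C₀, hC₀, hC⟩ := exists_abs_deriv_levelCutoff_le
  have hN' : (2 : ℝ) ≤ N := by exact_mod_cast hN
  set K := C₀ + N * Θ + N * L + L * (Θ + 1 + A ^ 2) with hK
  refine ⟨lintegralPowLePowLIntegralFDerivConst
        (volume : Measure (EuclideanSpace ℝ (Fin N))) ((N : ℝ) / (N - 1)) *
        |K| ^ ((N : ℝ) / (N - 1)), by positivity, ?_⟩
  intro α θ hα hθ hpos hA hθ1 hΘ hLα hLθ u hu hc
  have hL : 0 ≤ L := (norm_nonneg _).trans (hLα 0)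
  have hΘ0 : 0 ≤ Θ := by linarith [hθ1 0, hΘ 0]
  have hK0 : 0 ≤ K := by positivity
  have hwc : HasCompactSupport (sobLhs u α θ) := by
    refine hc.mono fun x hx => ?_
    contrapose! hx
    simp only [Function.mem_support, not_not] at hx ⊢
    simp [sobLhs, hx, levelCutoff_eq_zero]
  have := integral_rpow_le_of_norm_fderiv_le hN
    (h := fun x => K * sobRhs u α θ x) (contDiff_sobLhs hu hα hθ hpos) hwc
    (fun x => sobLhs_nonneg (hpos x).le) (isCompact_superlevel hu.continuous hc)
    (continuous_const.mul (continuous_sobRhs hu hα.continuous hθ.continuous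
      (fun x => one_pos.trans_le (hθ1 x)) fun x => Or.inl (hpos x).ne'))
    (fun x => mul_nonneg hK0 (sobRhs_nonneg (hpos x).le))
    (norm_fderiv_sobLhs_le hu hα hθ (by lia) hpos hA hθ1 hΘ hLα hLθ hC₀ hC)
  rw [abs_of_nonneg hK0]
  rwa [integral_const_mul, Real.mul_rpow hK0
    (integral_nonneg fun x => sobRhs_nonneg (hpos x).le), ← mul_assoc] at this

/-- Gagliardo-Nirenberg-Sobolev inequality for a variable exponent and a weight which are merely
Lipschitz. -/
theorem integral_sobLhs_le {N : ℕ} (hN : 2 ≤ N) {a θ : EuclideanSpace ℝ (Fin N) → ℝ}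
    {Ka Kθ : NNReal} (ha : LipschitzWith Ka a) (hθ : LipschitzWith Kθ θ) {A θ₀ Θ : ℝ}
    (ha0 : ∀ x, 0 ≤ a x) (haA : ∀ x, a x ≤ A) (hθ₀ : 1 < θ₀) (hθ1 : ∀ x, θ₀ ≤ θ x)
    (hΘ : ∀ x, θ x ≤ Θ) :
    ∃ C : ℝ, 0 ≤ C ∧ ∀ u : EuclideanSpace ℝ (Fin N) → ℝ, ContDiff ℝ 1 u → HasCompactSupport u →
      ∫ x in {x | 1 ≤ |u x|}, sobLhs u a θ x ^ ((N : ℝ) / (N - 1)) ≤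
        C * (∫ x in {x | 1 ≤ |u x|}, sobRhs u a θ x) ^ ((N : ℝ) / (N - 1)) := by
  have hN' : (2 : ℝ) ≤ N := by exact_mod_cast hN
  have hp0 : 0 < (N : ℝ) / (N - 1) := div_pos (by linarith) (by linarith)
  obtain ⟨C, hC0, hC⟩ := integral_sobLhs_le_of_contDiff hN (A := A + 1) (L := max Ka Kθ) (Θ := Θ)
  refine ⟨C, hC0, fun u hu hc => ?_⟩
  obtain ⟨α, hα1, hα2, hα3, hα4, hα5⟩ := exists_smooth_approx ha ha0 haA
  obtain ⟨τ, hτ1, hτ2, hτ3, hτ4, hτ5⟩ := exists_smooth_approx hθ hθ1 hΘ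
  have hA0 : 0 ≤ A := (ha0 0).trans (haA 0)
  have hΘ1 : 1 < Θ := hθ₀.trans_le ((hθ1 0).trans (hΘ 0))
  have hεpos : ∀ n : ℕ, (0 : ℝ) < 1 / ((n : ℝ) + 1) := fun n => by positivity
  have hεle : ∀ n : ℕ, (1 : ℝ) / ((n : ℝ) + 1) ≤ 1 := fun n => by
    rw [div_le_one (by positivity)]
    linarith [(Nat.cast_nonneg n : (0 : ℝ) ≤ n)]
  set β : ℕ → EuclideanSpace ℝ (Fin N) → ℝ := fun n x => α n x + 1 / ((n : ℝ) + 1) with hβ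
  have hβ1 : ∀ n, ContDiff ℝ 1 (β n) := fun n => (hα1 n).add contDiff_const
  have hβ0 : ∀ n x, 0 < β n x := fun n x => add_pos_of_nonneg_of_pos (hα3 n x) (hεpos n)
  have hβA : ∀ n x, β n x ≤ A + 1 := fun n x => add_le_add (hα4 n x) (hεle n)
  have hβ5 : ∀ x, Tendsto (fun n => β n x) atTop (nhds (a x)) := fun x => by
    simpa [hβ] using (hα5 x).add (tendsto_one_div_add_atTop_nhds_zero_nat (𝕜 := ℝ))
  have hS := isCompact_superlevel hu.continuous hc
  set S := {x | 1 ≤ |u x|} with hSdef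
  have hn := fun n => hC (β n) (τ n) (hβ1 n) (hτ1 n) (hβ0 n) (hβA n)
    (fun x => hθ₀.le.trans (hτ3 n x)) (hτ4 n)
    (fun x => by
      simp only [hβ, fderiv_add_const]
      exact (hα2 n x).trans (le_max_left _ _))
    (fun x => (hτ2 n x).trans (le_max_right _ _)) u hu hc
  obtain ⟨G, hG⟩ := (hS.bddAbove_image (continuous_bracket.comp hu.continuous).continuousOn)
  obtain ⟨D, hD⟩ := hS.bddAbove_image (hu.continuous_fderiv one_ne_zero).norm.continuousOn
  have hGx : ∀ x ∈ S, bracket (u x) ≤ G := fun x hx => hG ⟨x, hx, rfl⟩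
  have hDx : ∀ x ∈ S, ‖fderiv ℝ u x‖ ≤ D := fun x hx => hD ⟨x, hx, rfl⟩
  have hfin : IsFiniteMeasure (volume.restrict S) := ⟨by
    rw [Measure.restrict_apply_univ]; exact hS.measure_lt_top⟩
  have hbpow : ∀ x ∈ S, ∀ e : ℝ, e ≤ N * Θ → bracket (u x) ^ e ≤ G ^ (N * Θ) :=
    fun x hx e he => (Real.rpow_le_rpow_of_exponent_le (one_le_bracket _) he).trans
      (Real.rpow_le_rpow (bracket_pos _).le (hGx x hx) (by positivity))
  have hapow : ∀ n x, ∀ e : ℝ, 0 ≤ e → e ≤ Θ → β n x ^ e ≤ (A + 1) ^ Θ := fun n x e h0 he =>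
    (Real.rpow_le_rpow (hβ0 n x).le (hβA n x) h0).trans
      (Real.rpow_le_rpow_of_exponent_le (by linarith) he)
  have hlogG : ∀ x ∈ S, Real.log (bracket (u x)) ≤ G := fun x hx =>
    ((Real.log_le_sub_one_of_pos (bracket_pos _)).trans (by linarith)).trans (hGx x hx)
  have hconvl : ∀ x, Tendsto (fun n => sobLhs u (β n) (τ n) x) atTop (nhds (sobLhs u a θ x)) :=
    fun x => by
    have h1 : 0 < θ x := by linarith [hθ1 x]
    exact tendsto_const_nhds.mul (((hβ5 x).rpow (hτ5 x) (Or.inr h1)).mul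
      (tendsto_const_nhds.rpow (((hτ5 x).const_mul (N : ℝ)).sub_const _)
        (Or.inl (bracket_pos _).ne')))
  have hconvr : ∀ x, Tendsto (fun n => sobRhs u (β n) (τ n) x) atTop (nhds (sobRhs u a θ x)) :=
    fun x => by
    have h1 : 0 < θ x := by linarith [hθ1 x]
    have h2 : 0 < θ x - 1 := by linarith [hθ1 x]
    have hb : ∀ c : ℝ, Tendsto (fun n => bracket (u x) ^ (N * τ n x - c)) atTop
        (nhds (bracket (u x) ^ (N * θ x - c))) := fun c =>
      tendsto_const_nhds.rpow (((hτ5 x).const_mul (N : ℝ)).sub_const _)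
        (Or.inl (bracket_pos _).ne')
    have hA := (hβ5 x).rpow (hτ5 x) (Or.inr h1)
    have hA' := (hβ5 x).rpow ((hτ5 x).sub_const 1) (Or.inr h2)
    exact ((((hA.mul (hb _)).mul_const _).add ((hA.mul (hb _)).mul_const _))).add (hA'.mul (hb _))
  have hTheta0 : ∀ n x, 0 ≤ τ n x := fun n x => by linarith [hτ3 n x]
  have hNτ : ∀ n x, (N : ℝ) * τ n x ≤ N * Θ := fun n x => by
    have := hτ4 n x
    gcongr
  have hml : ∀ n, Continuous (sobLhs u (β n) (τ n)) := fun n =>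
    continuous_sobLhs hu.continuous (hβ1 n).continuous (hτ1 n).continuous
      fun x => by linarith [hτ3 n x]
  have hmr : ∀ n, Continuous (sobRhs u (β n) (τ n)) := fun n =>
    continuous_sobRhs hu (hβ1 n).continuous (hτ1 n).continuous
      (fun x => by linarith [hτ3 n x]) fun x => Or.inl (hβ0 n x).ne'
  have hl : Tendsto (fun n => ∫ x in S, sobLhs u (β n) (τ n) x ^ ((N : ℝ) / (N - 1))) atTop
      (nhds (∫ x in S, sobLhs u a θ x ^ ((N : ℝ) / (N - 1)))) := by
    refine tendsto_integral_of_dominated_convergence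
      (fun _ => ((A + 1) ^ Θ * G ^ (N * Θ)) ^ ((N : ℝ) / (N - 1)))
      (fun n => ((hml n).rpow_const fun x => Or.inr hp0.le).aestronglyMeasurable)
      (integrable_const _) (fun n => ?_)
      (Eventually.of_forall fun x => (hconvl x).rpow_const (Or.inr hp0.le))
    refine (ae_restrict_mem hS.measurableSet).mono fun x hx => ?_
    have h0 := sobLhs_nonneg (u := u) (θ := τ n) (hβ0 n x).le
    rw [Real.norm_of_nonneg (Real.rpow_nonneg h0 _)]
    refine Real.rpow_le_rpow h0 ?_ hp0.le
    have h1 : 0 ≤ β n x ^ τ n x := Real.rpow_nonneg (hβ0 n x).le _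
    have h2 : 0 ≤ bracket (u x) ^ (N * τ n x - (N - 1)) := Real.rpow_nonneg (bracket_pos _).le _
    refine (mul_le_of_le_one_left (mul_nonneg h1 h2) (levelCutoff_le_one _)).trans ?_
    exact mul_le_mul (hapow n x _ (hTheta0 n x) (hτ4 n x))
      (hbpow x hx _ (by linarith [hNτ n x])) h2 (by positivity)
  have hr : Tendsto (fun n => ∫ x in S, sobRhs u (β n) (τ n) x) atTop
      (nhds (∫ x in S, sobRhs u a θ x)) := by
    refine tendsto_integral_of_dominated_convergence
      (fun _ => (A + 1) ^ Θ * G ^ (N * Θ) * D + (A + 1) ^ Θ * G ^ (N * Θ) * G +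
        (A + 1) ^ Θ * G ^ (N * Θ))
      (fun n => (hmr n).aestronglyMeasurable)
      (integrable_const _) (fun n => ?_) (Eventually.of_forall hconvr)
    refine (ae_restrict_mem hS.measurableSet).mono fun x hx => ?_
    have h0 := sobRhs_nonneg (u := u) (θ := τ n) (hβ0 n x).le
    rw [Real.norm_of_nonneg h0]
    have hG0 : 0 ≤ G := (bracket_pos _).le.trans (hGx x hx)
    have h1 : ∀ e : ℝ, 0 ≤ bracket (u x) ^ e := fun e => Real.rpow_nonneg (bracket_pos _).le _
    have h2 := log_bracket_nonneg (u x)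
    rw [sobRhs]
    gcongr
    · exact h1 _
    · exact hapow n x _ (hTheta0 n x) (hτ4 n x)
    · exact hbpow x hx _ (by linarith [hNτ n x])
    · exact hDx x hx
    · exact h1 _
    · exact hapow n x _ (hTheta0 n x) (hτ4 n x)
    · exact hbpow x hx _ (by linarith [hNτ n x])
    · exact hlogG x hx
    · exact h1 _
    · exact hapow n x _ (by linarith [hτ3 n x]) (by linarith [hτ4 n x])
    · exact hbpow x hx _ (by linarith [hNτ n x])
  exact le_of_tendsto_of_tendsto' hl
    ((hr.rpow_const (Or.inr hp0.le)).const_mul C) hn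

theorem rpow_mul_rpow_le_of_one_le {X Y t b B : ℝ} (hX : 0 ≤ X) (hY : 0 ≤ Y) (ht : 0 ≤ t)
    (ht1 : t ≤ 1) (htb : t ≤ b) (hB : 1 ≤ B) :
    X ^ t * Y ^ (1 - t) ≤ B ^ b * (X / B + Y) := by
  have hB0 : 0 < B := by linarith
  have h1 : (X / B) ^ t * Y ^ (1 - t) ≤ t * (X / B) + (1 - t) * Y :=
    Real.geom_mean_le_arith_mean2_weighted ht (by linarith) (by positivity) hY (by ring)
  have h2 : X ^ t = B ^ t * (X / B) ^ t := by
    rw [← Real.mul_rpow hB0.le (by positivity), mul_div_cancel₀ _ hB0.ne']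
  have h3 : 0 ≤ X / B := by positivity
  calc X ^ t * Y ^ (1 - t) = B ^ t * ((X / B) ^ t * Y ^ (1 - t)) := by rw [h2]; ring
    _ ≤ B ^ b * (X / B + Y) := by
        have h4 := h1.trans (by nlinarith : t * (X / B) + (1 - t) * Y ≤ X / B + Y)
        exact mul_le_mul (Real.rpow_le_rpow_of_exponent_le hB htb) h4 (by positivity)
          (by positivity)

theorem rpow_mul_le_of_one_le {N : ℝ} (hN : 2 ≤ N) {X l B δ : ℝ} (hX : 0 ≤ X) (hl : 0 ≤ l)
    (hB : 1 ≤ B) (hδ : 0 < δ) :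
    X ^ (1 - 1 / N) * l ≤ B ^ (1 - 1 / N) * (δ * (X / B) + δ ^ (-(N - 1)) * l ^ N) := by
  have hB0 : 0 < B := by linarith
  have hN0 : N ≠ 0 := by linarith
  have hi : 1 / N ≤ 1 := by rw [div_le_one (by linarith)]; linarith
  have hi0 : 0 ≤ 1 / N := by positivity
  have h3 : 0 ≤ X / B := by positivity
  have h1 := Real.geom_mean_le_arith_mean2_weighted (w₁ := 1 - 1 / N) (w₂ := 1 / N)
    (p₁ := δ * (X / B)) (p₂ := δ ^ (-(N - 1)) * l ^ N) (by linarith) hi0 (by positivity)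
    (by positivity) (by ring)
  have h4 : (δ * (X / B)) ^ (1 - 1 / N) * (δ ^ (-(N - 1)) * l ^ N) ^ (1 / N) =
      (X / B) ^ (1 - 1 / N) * l := by
    rw [Real.mul_rpow hδ.le h3, Real.mul_rpow (by positivity) (by positivity),
      ← Real.rpow_mul hδ.le, ← Real.rpow_mul hl, mul_one_div_cancel hN0, Real.rpow_one]
    have : δ ^ (1 - 1 / N) * δ ^ (-(N - 1) * (1 / N)) = 1 := by
      rw [← Real.rpow_add hδ]
      convert Real.rpow_zero δ using 2
      field_simp
      ring
    linear_combination (X / B) ^ (1 - 1 / N) * l * this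
  have h2 : X ^ (1 - 1 / N) = B ^ (1 - 1 / N) * (X / B) ^ (1 - 1 / N) := by
    rw [← Real.mul_rpow hB0.le (by positivity), mul_div_cancel₀ _ hB0.ne']
  rw [h4] at h1
  calc X ^ (1 - 1 / N) * l = B ^ (1 - 1 / N) * ((X / B) ^ (1 - 1 / N) * l) := by rw [h2]; ring
    _ ≤ _ := by
        gcongr
        refine h1.trans (add_le_add ?_ ?_)
        · exact mul_le_of_le_one_left (by positivity) (by linarith)
        · exact mul_le_of_le_one_left (by positivity) hi

/-- A self-improving inequality with a sublinear right-hand side bounds its argument. -/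
theorem le_rpow_of_rpow_le {B γ β K : ℝ} (hB : 1 ≤ B) (hβ : 0 ≤ β) (hβγ : β < γ) (hK : 0 ≤ K)
    (h : B ^ γ ≤ K * (1 + B ^ β) + B ^ γ / 2) : B ≤ (4 * K) ^ (1 / (γ - β)) := by
  have hB0 : 0 < B := by linarith
  have h1 : 1 ≤ B ^ β := Real.one_le_rpow hB hβ
  have h2 : B ^ γ ≤ 4 * K * B ^ β := by nlinarith
  have h3 : B ^ (γ - β) ≤ 4 * K := by
    rw [Real.rpow_sub hB0, div_le_iff₀ (by positivity)]
    exact h2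
  calc B = (B ^ (γ - β)) ^ (1 / (γ - β)) := by
        rw [← Real.rpow_mul hB0.le, mul_one_div_cancel (by linarith), Real.rpow_one]
    _ ≤ _ := Real.rpow_le_rpow (by positivity) h3 (by
        rw [one_div]; exact inv_nonneg.2 (by linarith))

/-- The critical integrand `(a ⟨u⟩^q)^{N/(N-q)}`. -/
noncomputable def critInt {N : ℕ} (u a q : EuclideanSpace ℝ (Fin N) → ℝ)
    (x : EuclideanSpace ℝ (Fin N)) : ℝ :=
  (a x * bracket (u x) ^ q x) ^ ((N : ℝ) / (N - q x))

theorem mul_rpow_rpow_rpow {a g q κ : ℝ} (ha : 0 ≤ a) (hg : 0 < g) (e : ℝ) :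
    ((a * g ^ q) ^ κ) ^ e = a ^ (κ * e) * g ^ (q * (κ * e)) := by
  rw [← Real.rpow_mul (by positivity), Real.mul_rpow ha (by positivity), ← Real.rpow_mul hg.le]

theorem gradient_term_eq {N a g q d : ℝ} (ha : 0 ≤ a) (hg : 0 < g) (hd : 0 ≤ d) (hq1 : 1 < q)
    (hqN : q < N) :
    a ^ ((N - 1) / (N - q)) * g ^ (N * ((N - 1) / (N - q)) - N) * d =
      ((a * g ^ q) ^ (N / (N - q))) ^ (1 - 1 / q) * (a * d ^ q) ^ (1 - (1 - 1 / q)) := by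
  have hNq : N - q ≠ 0 := by linarith
  have hq0 : q ≠ 0 := by linarith
  have hqi : 1 / q ≤ 1 := by rw [div_le_one (by linarith)]; linarith
  rw [mul_rpow_rpow_rpow ha hg, Real.mul_rpow ha (by positivity), ← Real.rpow_mul hd,
    show q * (1 - (1 - 1 / q)) = 1 by field_simp; ring, Real.rpow_one,
    show (N - 1) / (N - q) = N / (N - q) * (1 - 1 / q) + (1 - (1 - 1 / q)) by field_simp; ring,
    Real.rpow_add_of_nonneg ha
      (mul_nonneg (div_nonneg (by linarith) (by linarith)) (by linarith)) (by
        rw [sub_sub_cancel]; exact one_div_nonneg.2 (by linarith)),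
    show N * (N / (N - q) * (1 - 1 / q) + (1 - (1 - 1 / q))) - N
      = q * (N / (N - q) * (1 - 1 / q)) by field_simp; ring]
  ring

theorem log_term_eq {N a g q : ℝ} (ha : 0 ≤ a) (hg : 0 < g) (hq1 : 1 < q) (hqN : q < N) :
    a ^ ((N - 1) / (N - q)) * g ^ (N * ((N - 1) / (N - q)) - (N - 1)) =
      ((a * g ^ q) ^ (N / (N - q))) ^ (1 - 1 / N) := by
  have hNq : N - q ≠ 0 := by linarith
  have hN0 : N ≠ 0 := by linarith
  rw [mul_rpow_rpow_rpow ha hg]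
  congr 2 <;> (field_simp; try ring)

theorem weight_term_eq {N a g q : ℝ} (ha : 0 ≤ a) (hg : 0 < g) (hq1 : 1 < q) (hqN : q < N) :
    a ^ ((N - 1) / (N - q) - 1) * g ^ (N * ((N - 1) / (N - q)) - (N - 1)) =
      ((a * g ^ q) ^ (N / (N - q))) ^ ((q - 1) / N) *
        (g ^ (N * q / (N - q + 1))) ^ (1 - (q - 1) / N) := by
  have hNq : N - q ≠ 0 := by linarith
  have hNq1 : N - q + 1 ≠ 0 := by linarith
  have hN0 : N ≠ 0 := by linarith
  rw [mul_rpow_rpow_rpow ha hg, ← Real.rpow_mul hg.le, mul_assoc, ← Real.rpow_add hg]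
  congr 2 <;> (field_simp; try ring)

theorem mul_rpow_rpow_le_of_le {N A Q a g q T : ℝ} (hQN : Q < N) (ha : 0 ≤ a) (haA : a ≤ A)
    (hg : 1 ≤ g) (hgT : g ≤ T) (hq1 : 1 < q) (hqQ : q ≤ Q) :
    (a * g ^ q) ^ (N / (N - q)) ≤ ((1 + A) * T ^ N) ^ (N / (N - Q)) := by
  have hT : 1 ≤ T := hg.trans hgT
  have h1 : a * g ^ q ≤ (1 + A) * T ^ N :=
    mul_le_mul (by linarith) ((Real.rpow_le_rpow (by linarith) hgT (by linarith)).trans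
      (Real.rpow_le_rpow_of_exponent_le hT (by linarith))) (by positivity) (by linarith)
  have h2 : 1 ≤ (1 + A) * T ^ N :=
    one_le_mul_of_one_le_of_one_le (by linarith) (Real.one_le_rpow hT (by linarith))
  refine (Real.rpow_le_rpow (by positivity) h1
    (div_nonneg (by linarith) (by linarith))).trans
    (Real.rpow_le_rpow_of_exponent_le h2 ?_)
  exact div_le_div_of_nonneg_left (by linarith) (by linarith) (by linarith)

theorem log_term_le {N A Q δ : ℝ} (hN : 2 ≤ N) (hA : 0 ≤ A) (hQN : Q < N) (hδ : 0 < δ) :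
    ∃ c : ℝ, 0 ≤ c ∧ ∀ a g q B : ℝ, 0 ≤ a → a ≤ A → 1 ≤ g → 1 < q → q ≤ Q → 1 ≤ B →
      ((a * g ^ q) ^ (N / (N - q))) ^ (1 - 1 / N) * Real.log g ≤
        B ^ (1 - 1 / N) * (δ * ((a * g ^ q) ^ (N / (N - q)) / B + g)) + c := by
  set D := δ ^ (-(N - 1)) * (2 * N) ^ N with hD
  have hD0 : 0 < D := by positivity
  set T := max 1 ((D / δ) ^ 2) with hT
  have hT1 : 1 ≤ T := le_max_left _ _
  have hγ : 0 ≤ 1 - 1 / N := by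
    have : 1 / N ≤ 1 := by rw [div_le_one (by linarith)]; linarith
    linarith
  refine ⟨(((1 + A) * T ^ N) ^ (N / (N - Q))) ^ (1 - 1 / N) * T, by positivity, ?_⟩
  intro a g q B ha haA hg hq1 hqQ hB
  have hg0 : 0 < g := by linarith
  have hl : 0 ≤ Real.log g := Real.log_nonneg hg
  have hZ : 0 ≤ (a * g ^ q) ^ (N / (N - q)) := by positivity
  by_cases hgT : g ≤ T
  · have h1 := mul_rpow_rpow_le_of_le hQN ha haA hg hgT hq1 hqQ
    have h2 : Real.log g ≤ T :=
      ((Real.log_le_sub_one_of_pos hg0).trans (by linarith)).trans hgT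
    refine le_add_of_nonneg_of_le (by positivity) ?_
    gcongr
  · push Not at hgT
    refine le_add_of_le_of_nonneg ?_ (by positivity)
    refine (rpow_mul_le_of_one_le hN hZ hl hB hδ).trans ?_
    refine mul_le_mul_of_nonneg_left ?_ (by positivity)
    rw [mul_add]
    refine add_le_add le_rfl ?_
    have h1 : Real.log g ≤ 2 * N * g ^ (1 / (2 * N)) := by
      refine (Real.log_le_rpow_div hg0.le (ε := 1 / (2 * N)) (by positivity)).trans (le_of_eq ?_)
      field_simp
    have h2 : Real.log g ^ N ≤ (2 * N) ^ N * Real.sqrt g := by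
      refine (Real.rpow_le_rpow hl h1 (by linarith)).trans (le_of_eq ?_)
      rw [Real.mul_rpow (by positivity) (by positivity), ← Real.rpow_mul hg0.le,
        Real.sqrt_eq_rpow]
      congr 2
      field_simp
    have h3 : D / δ ≤ Real.sqrt g :=
      Real.le_sqrt_of_sq_le (((le_max_right _ _).trans hgT.le))
    calc δ ^ (-(N - 1)) * Real.log g ^ N ≤ δ ^ (-(N - 1)) * ((2 * N) ^ N * Real.sqrt g) := by
          gcongr
      _ = D * Real.sqrt g := by rw [hD]; ring
      _ ≤ (δ * Real.sqrt g) * Real.sqrt g := by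
          gcongr
          rwa [div_le_iff₀' hδ] at h3
      _ = δ * g := by rw [mul_assoc, Real.mul_self_sqrt hg0.le]

theorem lipschitzWith_critical_ratio {X : Type*} [PseudoMetricSpace X] {N Q : ℝ} {q : X → ℝ}
    {K : NNReal} (hq : LipschitzWith K q) (hQ : ∀ x, q x ≤ Q) (hQN : Q < N) (hN : 1 ≤ N) :
    ∃ K' : NNReal, LipschitzWith K' fun x => (N - 1) / (N - q x) := by
  refine ⟨(Real.toNNReal ((N - 1) / (N - Q) ^ 2)) * K, LipschitzWith.of_dist_le_mul fun x y => ?_⟩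
  have h0 : 0 < N - Q := by linarith
  have hx : N - Q ≤ N - q x := by linarith [hQ x]
  have hy : N - Q ≤ N - q y := by linarith [hQ y]
  have h := hq.dist_le_mul x y
  have hx0 : 0 < N - q x := by linarith
  have hy0 : 0 < N - q y := by linarith
  have h1 : 0 ≤ N - 1 := by linarith
  rw [NNReal.coe_mul, Real.coe_toNNReal _ (by positivity), Real.dist_eq,
    show (N - 1) / (N - q x) - (N - 1) / (N - q y) =
      (N - 1) * (q x - q y) / ((N - q x) * (N - q y)) by field_simp; ring,
    abs_div, abs_mul, abs_of_nonneg h1, abs_of_pos (mul_pos hx0 hy0), mul_assoc, div_mul_eq_mul_div]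
  rw [Real.dist_eq] at h
  have h2 : (N - Q) ^ 2 ≤ (N - q x) * (N - q y) := by rw [sq]; gcongr
  gcongr

theorem critInt_nonneg {N : ℕ} {u a q : EuclideanSpace ℝ (Fin N) → ℝ} {x} (ha : 0 ≤ a x) :
    0 ≤ critInt u a q x :=
  Real.rpow_nonneg (mul_nonneg ha (Real.rpow_nonneg (bracket_pos _).le _)) _

theorem continuous_critInt {N : ℕ} {u a q : EuclideanSpace ℝ (Fin N) → ℝ} (hu : Continuous u)
    (ha : Continuous a) (hq : Continuous q) (hq1 : ∀ x, 1 < q x) (hqN : ∀ x, q x < N) :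
    Continuous (critInt u a q) := by
  refine (ha.mul ((continuous_bracket.comp hu).rpow hq
    fun x => Or.inl (bracket_pos _).ne')).rpow (continuous_const.div (continuous_const.sub hq)
    fun x => (sub_pos.2 (hqN x)).ne') fun x => Or.inr ?_
  exact div_pos (by linarith [hq1 x, hqN x]) (sub_pos.2 (hqN x))

theorem critInt_le_sobLhs_rpow_add {N : ℕ} {u a q : EuclideanSpace ℝ (Fin N) → ℝ} {A Q : ℝ}
    (ha : ∀ x, 0 ≤ a x) (haA : ∀ x, a x ≤ A) (hq1 : ∀ x, 1 < q x) (hqQ : ∀ x, q x ≤ Q)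
    (hQN : Q < N) (x) :
    critInt u a q x ≤ sobLhs u a (fun x => ((N : ℝ) - 1) / (N - q x)) x ^ ((N : ℝ) / (N - 1)) +
      ((1 + A) * 3 ^ (N : ℝ)) ^ ((N : ℝ) / (N - Q)) := by
  have hA : 0 ≤ A := (ha x).trans (haA x)
  have hN1 : (1 : ℝ) < N := by linarith [hq1 x, hqQ x]
  by_cases h : 2 ≤ |u x|
  · refine le_add_of_le_of_nonneg (le_of_eq ?_) (by positivity)
    have hZ : 0 ≤ (a x * bracket (u x) ^ q x) ^ ((N : ℝ) / (N - q x)) := critInt_nonneg (ha x)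
    rw [sobLhs, levelCutoff_eq_one h, one_mul,
      log_term_eq (ha x) (bracket_pos _) (hq1 x) ((hqQ x).trans_lt hQN), ← Real.rpow_mul hZ]
    have : (1 - 1 / (N : ℝ)) * (N / (N - 1)) = 1 := by
      have : (N : ℝ) - 1 ≠ 0 := by linarith
      field_simp
    rw [this, Real.rpow_one, critInt]
  · push Not at h
    refine le_add_of_nonneg_of_le (Real.rpow_nonneg (sobLhs_nonneg (ha x)) _) ?_
    refine mul_rpow_rpow_le_of_le hQN (ha x) (haA x) (one_le_bracket _) ?_ (hq1 x) (hqQ x)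
    refine Real.sqrt_le_iff.2 ⟨by norm_num, ?_⟩
    nlinarith [abs_nonneg (u x), sq_abs (u x)]

theorem sobRhs_le {N : ℕ} (hN : 2 ≤ N) {A Q δ : ℝ} (hA : 0 ≤ A) (hQN : Q < N) (hδ : 0 < δ) :
    ∃ c : ℝ, 0 ≤ c ∧ ∀ (u a q : EuclideanSpace ℝ (Fin N) → ℝ) (B W : ℝ) (x), 1 ≤ B →
      0 ≤ a x → a x ≤ A → 1 < q x → q x ≤ Q → 1 ≤ |u x| → 0 ≤ W →
      (a x = 1 ∨ bracket (u x) ^ (N * q x / (N - q x + 1)) ≤ W) →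
      sobRhs u a (fun x => ((N : ℝ) - 1) / (N - q x)) x ≤
        B ^ (1 - 1 / Q) * (2 * (critInt u a q x / B) + a x * ‖fderiv ℝ u x‖ ^ q x + W) +
        (1 + 2 / Real.log 2) *
          (B ^ (1 - 1 / (N : ℝ)) * (δ * (critInt u a q x / B + bracket (u x))) + c) := by
  have hN' : (2 : ℝ) ≤ N := by exact_mod_cast hN
  obtain ⟨c, hc, h⟩ := log_term_le hN' hA hQN hδ
  refine ⟨c, hc, fun u a q B W x hB ha haA hq1 hqQ hu hW hor => ?_⟩
  have hqN : q x < N := hqQ.trans_lt hQN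
  have hg := bracket_pos (u x)
  have hg1 := one_le_bracket (u x)
  have hd : 0 ≤ a x * ‖fderiv ℝ u x‖ ^ q x := by positivity
  have hZ : 0 ≤ critInt u a q x := critInt_nonneg ha
  have hZB : 0 ≤ critInt u a q x / B := by positivity
  have hβ : 1 - 1 / q x ≤ 1 - 1 / Q := by
    have := one_div_le_one_div_of_le (by linarith) hqQ
    linarith
  have hqi : 1 / q x < 1 := by rw [div_lt_one (by linarith)]; exact hq1
  have hqi0 : 0 < 1 / q x := by positivity
  have hBβ : 0 ≤ B ^ (1 - 1 / Q) := by positivity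
  have hT1 := rpow_mul_rpow_le_of_one_le (t := 1 - 1 / q x) hZ hd (by linarith) (by linarith) hβ hB
  rw [critInt, ← gradient_term_eq ha hg (norm_nonneg _) hq1 hqN] at hT1
  have hT2 := h (a x) (bracket (u x)) (q x) B ha haA hg1 hq1 hqQ hB
  rw [← log_term_eq ha hg hq1 hqN] at hT2
  have hT2' : 0 ≤ a x ^ (((N : ℝ) - 1) / (N - q x)) *
      bracket (u x) ^ (N * (((N : ℝ) - 1) / (N - q x)) - (N - 1)) * Real.log (bracket (u x)) :=
    mul_nonneg (by positivity) (log_bracket_nonneg _)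
  have hl2 : 0 < Real.log 2 := Real.log_pos (by norm_num)
  have hT3 : a x ^ (((N : ℝ) - 1) / (N - q x) - 1) *
      bracket (u x) ^ (N * (((N : ℝ) - 1) / (N - q x)) - (N - 1)) ≤
      B ^ (1 - 1 / Q) * (critInt u a q x / B + W) +
        2 / Real.log 2 * (a x ^ (((N : ℝ) - 1) / (N - q x)) *
      bracket (u x) ^ (N * (((N : ℝ) - 1) / (N - q x)) - (N - 1)) *
        Real.log (bracket (u x))) := by
    rcases hor with h1 | h1
    · refine le_add_of_nonneg_of_le (by positivity) ?_
      have hl : 1 ≤ 2 / Real.log 2 * Real.log (bracket (u x)) := by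
        rw [log_bracket, div_mul_div_comm, mul_comm, mul_div_mul_right _ _ two_ne_zero,
          one_le_div hl2]
        exact Real.log_le_log two_pos (by nlinarith [sq_abs (u x)])
      rw [h1, Real.one_rpow, Real.one_rpow, one_mul]
      have : 0 ≤ bracket (u x) ^ (N * (((N : ℝ) - 1) / (N - q x)) - (N - 1)) := by positivity
      nlinarith
    · refine le_add_of_le_of_nonneg ?_ (mul_nonneg (by positivity) hT2')
      rw [weight_term_eq ha hg hq1 hqN]
      have ht : (q x - 1) / N ≤ 1 - 1 / q x := by
        rw [show 1 - 1 / q x = (q x - 1) / q x by field_simp]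
        exact div_le_div_of_nonneg_left (by linarith) (by linarith) hqN.le
      refine (rpow_mul_rpow_le_of_one_le hZ (by positivity)
        (div_nonneg (by linarith) (by linarith)) (by linarith) (ht.trans hβ) hB).trans ?_
      gcongr
  rw [sobRhs]
  rw [← critInt] at hT1 hT2
  have hk : 0 ≤ 2 / Real.log 2 := by positivity
  have h4 := mul_le_mul_of_nonneg_left hT2 hk
  linear_combination hT1 + hT2 + hT3 + h4

theorem integral_critInt_le {N : ℕ} (hN : 2 ≤ N) {a q : EuclideanSpace ℝ (Fin N) → ℝ}
    {Ka Kq : NNReal} (ha : LipschitzWith Ka a) (hq : LipschitzWith Kq q) {A q₀ Q : ℝ}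
    (ha0 : ∀ x, 0 ≤ a x) (haA : ∀ x, a x ≤ A) (hq₀ : 1 < q₀) (hq1 : ∀ x, q₀ ≤ q x)
    (hqQ : ∀ x, q x ≤ Q) (hQN : Q < N) {M : ℝ} (hM : 0 ≤ M) :
    ∃ C : ℝ, ∀ u : EuclideanSpace ℝ (Fin N) → ℝ, ContDiff ℝ 1 u → HasCompactSupport u →
      volume.real {x | 1 ≤ |u x|} ≤ M →
      ∫ x in {x | 1 ≤ |u x|}, a x * ‖fderiv ℝ u x‖ ^ q x ≤ M →
      ∫ x in {x | 1 ≤ |u x|}, bracket (u x) ≤ M →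
      ((∀ x, a x = 1) ∨
        ∫ x in {x | 1 ≤ |u x|}, bracket (u x) ^ (N * q x / (N - q x + 1)) ≤ M) →
      ∫ x in {x | 1 ≤ |u x|}, critInt u a q x ≤ C := by
  have hN' : (2 : ℝ) ≤ N := by exact_mod_cast hN
  have hA : 0 ≤ A := (ha0 0).trans (haA 0)
  have hq1' : ∀ x, 1 < q x := fun x => hq₀.trans_le (hq1 x)
  have hqN : ∀ x, q x < N := fun x => (hqQ x).trans_lt hQN
  have hQ1 : 1 < Q := (hq1' 0).trans_le (hqQ 0)
  obtain ⟨Kθ, hθ⟩ := lipschitzWith_critical_ratio hq hqQ hQN (by linarith)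
  have hθ₀ : 1 < ((N : ℝ) - 1) / (N - q₀) := by
    rw [one_lt_div (by linarith [hq1 0, hqN 0])]; linarith
  obtain ⟨C₀, hC₀, hGNS⟩ := integral_sobLhs_le hN ha hθ ha0 haA hθ₀
    (fun x => div_le_div_of_nonneg_left (by linarith) (by linarith [hqN x]) (by linarith [hq1 x]))
    (Θ := ((N : ℝ) - 1) / (N - Q))
    (fun x => div_le_div_of_nonneg_left (by linarith) (by linarith [hqN x]) (by linarith [hqQ x]))
  set c₁ := ((1 + A) * 3 ^ (N : ℝ)) ^ ((N : ℝ) / (N - Q)) with hc₁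
  have hc₁0 : 0 ≤ c₁ := by positivity
  set γ := 1 - 1 / (N : ℝ) with hγ
  set β := 1 - 1 / Q with hβ
  set k := 1 + 2 / Real.log 2 with hk
  have hk0 : 0 < k := by have := Real.log_pos one_lt_two; positivity
  have hβ0 : 0 ≤ β := by
    have : 1 / Q ≤ 1 := by rw [div_le_one (by linarith)]; exact hQ1.le
    linarith
  have hβγ : β < γ := by
    have : 1 / (N : ℝ) < 1 / Q := one_div_lt_one_div_of_lt (by linarith) hQN
    linarith
  have hγ0 : 0 ≤ γ := hβ0.trans hβγ.le
  have hγ1 : γ ≤ 1 := by have : 0 ≤ 1 / (N : ℝ) := by positivity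
                         linarith
  set D := C₀ ^ γ with hD
  have hD0 : 0 ≤ D := by positivity
  set δ := 1 / (2 * (D + 1) * k * (1 + M)) with hδ
  have hδ0 : 0 < δ := by positivity
  have hDδ : D * (k * (δ * (1 + M))) ≤ 1 / 2 := by
    rw [hδ]
    field_simp
    linarith
  obtain ⟨c, hc, hrhs⟩ := sobRhs_le hN hA hQN hδ0
  set K := (c₁ * M) ^ γ + D * (2 + 2 * M + k * (c * M)) with hK
  have hK0 : 0 ≤ K := by positivity
  refine ⟨max 1 ((4 * K) ^ (1 / (γ - β))), fun u hu huc hvol hgrad hg hor => ?_⟩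
  have hS := isCompact_superlevel hu.continuous huc
  set S := {x | 1 ≤ |u x|} with hSdef
  have hintg : ∀ f : EuclideanSpace ℝ (Fin N) → ℝ, Continuous f → IntegrableOn f S := fun f hf =>
    hf.continuousOn.integrableOn_compact hS
  have hac := ha.continuous
  have hqc := hq.continuous
  have hbc : Continuous fun x => bracket (u x) := continuous_bracket.comp hu.continuous
  have hZc := continuous_critInt hu.continuous hac hqc hq1' hqN
  have hdc : Continuous fun x => a x * ‖fderiv ℝ u x‖ ^ q x :=
    hac.mul ((hu.continuous_fderiv one_ne_zero).norm.rpow hqc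
      fun x => Or.inr (one_pos.trans (hq1' x)))
  obtain ⟨W, hWc, hW0, hWM, hW⟩ : ∃ W : EuclideanSpace ℝ (Fin N) → ℝ, Continuous W ∧
      (∀ x, 0 ≤ W x) ∧ ∫ x in S, W x ≤ M ∧
      ∀ x, a x = 1 ∨ bracket (u x) ^ (N * q x / (N - q x + 1)) ≤ W x := by
    rcases hor with h | h
    · exact ⟨fun _ => 0, continuous_const, fun _ => le_rfl, by simpa using hM,
        fun x => Or.inl (h x)⟩
    · refine ⟨_, ?_, fun x => Real.rpow_nonneg (bracket_pos _).le _, h, fun x => Or.inr le_rfl⟩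
      exact hbc.rpow ((continuous_const.mul hqc).div
        ((continuous_const.sub hqc).add continuous_const)
        fun x => by linarith [hqN x]) fun x => Or.inl (bracket_pos _).ne'
  set B := ∫ x in S, critInt u a q x with hB
  rcases le_total B 1 with hB1 | hB1
  · exact hB1.trans (le_max_left _ _)
  refine le_trans ?_ (le_max_right _ _)
  have hB0 : 0 < B := by linarith
  set θ : EuclideanSpace ℝ (Fin N) → ℝ := fun x => ((N : ℝ) - 1) / (N - q x) with hθdef
  have hθpos : ∀ x, 1 < θ x := fun x => by
    rw [hθdef]
    simp only
    rw [one_lt_div (by linarith [hqN x])]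
    linarith [hq1' x]
  set R := ∫ x in S, sobRhs u a θ x with hR
  have hR0 : 0 ≤ R := integral_nonneg fun x => sobRhs_nonneg (ha0 x)
  have hRc : Continuous (sobRhs u a θ) := continuous_sobRhs hu hac hθ.continuous
    (fun x => one_pos.trans (hθpos x)) fun x => Or.inr (hθpos x)
  have hR1 : R ≤ B ^ β * (2 + 2 * M) + k * (B ^ γ * (δ * (1 + M)) + c * M) := by
    have hle : R ≤ ∫ x in S, (B ^ β * (2 * (critInt u a q x / B) +
        a x * ‖fderiv ℝ u x‖ ^ q x + W x) +
        k * (B ^ γ * (δ * (critInt u a q x / B + bracket (u x))) + c)) := by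
      refine setIntegral_mono_on (hintg _ hRc) (hintg _ ?_) hS.measurableSet fun x hx =>
        hrhs u a q B (W x) x hB1 (ha0 x) (haA x) (hq1' x) (hqQ x) hx (hW0 x) (hW x)
      exact (continuous_const.mul (((continuous_const.mul (hZc.div_const _)).add hdc).add hWc)).add
        (continuous_const.mul ((continuous_const.mul (continuous_const.mul
          ((hZc.div_const _).add hbc))).add continuous_const))
    have hi : ∀ (e : ℝ) (f : EuclideanSpace ℝ (Fin N) → ℝ), Continuous f →
        IntegrableOn (fun x => e * f x) S := fun e f hf => hintg _ (continuous_const.mul hf)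
    have e1 : ∫ x in S, (B ^ β * (2 * (critInt u a q x / B) +
        a x * ‖fderiv ℝ u x‖ ^ q x + W x) +
        k * (B ^ γ * (δ * (critInt u a q x / B + bracket (u x))) + c)) =
        ∫ x in S, (((2 * B ^ β + k * (B ^ γ * δ)) / B * critInt u a q x +
          B ^ β * (a x * ‖fderiv ℝ u x‖ ^ q x)) + (B ^ β * W x +
          (k * (B ^ γ * δ)) * bracket (u x)) + k * c * 1) := by
      congr 1 with x
      field_simp
      ring
    rw [e1, integral_add _ (hi _ _ continuous_const), integral_add, integral_add (hi _ _ hZc)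
      (hi _ _ hdc), integral_add (hi _ _ hWc) (hi _ _ hbc)] at hle
    · simp only [integral_const_mul, setIntegral_const, smul_eq_mul, mul_one] at hle
      rw [← hB, div_mul_cancel₀ _ hB0.ne'] at hle
      have h1 := mul_le_mul_of_nonneg_left hgrad (by positivity : 0 ≤ B ^ β)
      have h2 := mul_le_mul_of_nonneg_left hWM (by positivity : 0 ≤ B ^ β)
      have h3 := mul_le_mul_of_nonneg_left hg (by positivity : 0 ≤ k * (B ^ γ * δ))
      have h4 := mul_le_mul_of_nonneg_left hvol (by positivity : 0 ≤ k * c)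
      linear_combination hle + h1 + h2 + h3 + h4
    · exact (hi _ _ hZc).add (hi _ _ hdc)
    · exact (hi _ _ hWc).add (hi _ _ hbc)
    · exact ((hi _ _ hZc).add (hi _ _ hdc)).add ((hi _ _ hWc).add (hi _ _ hbc))
  have hR2 : B ≤ C₀ * R ^ ((N : ℝ) / (N - 1)) + c₁ * M := by
    have hLc : Continuous fun x => sobLhs u a θ x ^ ((N : ℝ) / (N - 1)) :=
      (continuous_sobLhs hu.continuous hac hθ.continuous
        fun x => one_pos.trans (hθpos x)).rpow_const
        fun x => Or.inr (div_nonneg (by linarith) (by linarith))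
    have h1 : B ≤ ∫ x in S, (sobLhs u a θ x ^ ((N : ℝ) / (N - 1)) + c₁) :=
      setIntegral_mono_on (hintg _ hZc) (hintg _ (hLc.add continuous_const)) hS.measurableSet
        fun x _ => critInt_le_sobLhs_rpow_add ha0 haA hq1' hqQ hQN x
    rw [integral_add (hintg _ hLc) (hintg _ continuous_const), setIntegral_const, smul_eq_mul,
      mul_comm (volume.real S)] at h1
    exact h1.trans (add_le_add (hGNS u hu huc) (mul_le_mul_of_nonneg_left hvol hc₁0))
  have hR3 : B ^ γ ≤ D * R + (c₁ * M) ^ γ := by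
    refine (Real.rpow_le_rpow hB0.le hR2 hγ0).trans ((Real.rpow_add_le_add_rpow
      (by positivity) (by positivity) hγ0 hγ1).trans (le_of_eq ?_))
    rw [Real.mul_rpow hC₀ (by positivity), ← Real.rpow_mul hR0]
    have : (N : ℝ) / (N - 1) * γ = 1 := by
      have : (N : ℝ) - 1 ≠ 0 := by linarith
      rw [hγ]
      field_simp
    rw [this, Real.rpow_one]
  refine le_rpow_of_rpow_le hB1 hβ0 hβγ hK0 ?_
  have h1 : 0 ≤ B ^ β := by positivity
  have h2 : 0 ≤ B ^ γ := by positivity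
  have h3 := mul_le_mul_of_nonneg_left hR1 hD0
  have h4 := mul_le_mul_of_nonneg_right hDδ h2
  have h5 : 0 ≤ B ^ β * ((c₁ * M) ^ γ + D * (k * (c * M))) := by positivity
  have h6 : 0 ≤ D * (2 + 2 * M) := by positivity
  rw [hK]
  linarith

theorem contDiff_bracket : ContDiff ℝ 1 bracket := by
  unfold bracket
  refine ContDiff.sqrt (by fun_prop) fun x => by positivity

theorem exists_abs_deriv_levelCutoff_mul_bracket_le :
    ∃ C : ℝ, 0 ≤ C ∧ (∀ t, |deriv (fun t => levelCutoff t * bracket t) t| ≤ C) ∧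
      ∀ t, |t| < 1 → deriv (fun t => levelCutoff t * bracket t) t = 0 := by
  obtain ⟨C, hC, h⟩ := exists_abs_deriv_levelCutoff_le
  have hd : ∀ t, deriv (fun t => levelCutoff t * bracket t) t =
      deriv levelCutoff t * bracket t + levelCutoff t * deriv bracket t := fun t =>
    deriv_fun_mul (contDiff_levelCutoff.differentiable one_ne_zero t)
      (contDiff_bracket.differentiable one_ne_zero t)
  have hb : ∀ t, |deriv bracket t| ≤ 1 := fun t => by
    have h1 : HasDerivAt (fun t : ℝ => 1 + t ^ 2) (2 * t) t := by
      simpa using (hasDerivAt_pow 2 t).const_add 1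
    have h2 : HasDerivAt bracket (2 * t / (2 * bracket t)) t := h1.sqrt (by positivity)
    rw [h2.deriv, mul_div_mul_left _ _ two_ne_zero, abs_div, abs_of_pos (bracket_pos t),
      div_le_one (bracket_pos t)]
    exact abs_le_bracket t
  refine ⟨C + 1, by positivity, fun t => ?_, fun t ht => ?_⟩
  · rw [hd]
    refine (abs_add_le _ _).trans (add_le_add ?_ ?_)
    · rw [abs_mul, abs_of_pos (bracket_pos t), ← le_div_iff₀ (bracket_pos t)]
      exact h t
    · rw [abs_mul, abs_of_nonneg (levelCutoff_nonneg t)]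
      exact mul_le_one₀ (levelCutoff_le_one t) (abs_nonneg _) (hb t)
  · rw [hd, deriv_levelCutoff_eq_zero_of_lt_one ht, levelCutoff_eq_zero ht.le]
    ring

theorem integral_bracket_le {N : ℕ} (hN : 2 ≤ N) (M : ℝ) :
    ∃ C : ℝ, ∀ u : EuclideanSpace ℝ (Fin N) → ℝ, ContDiff ℝ 1 u → HasCompactSupport u →
      volume.real {x | 1 ≤ |u x|} ≤ M → ∫ x in {x | 1 ≤ |u x|}, ‖fderiv ℝ u x‖ ≤ M →
      ∫ x in {x | 1 ≤ |u x|}, bracket (u x) ≤ C := by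
  have hN' : (2 : ℝ) ≤ N := by exact_mod_cast hN
  obtain ⟨C, hC, hle, hzero⟩ := exists_abs_deriv_levelCutoff_mul_bracket_le
  refine ⟨lintegralPowLePowLIntegralFDerivConst
    (volume : Measure (EuclideanSpace ℝ (Fin N))) ((N : ℝ) / (N - 1)) *
      (C * M) ^ ((N : ℝ) / (N - 1)) + M * 3, fun u hu huc hvol hgrad => ?_⟩
  have hS := isCompact_superlevel hu.continuous huc
  set S := {x | 1 ≤ |u x|} with hSdef
  have hψ : ContDiff ℝ 1 fun t => levelCutoff t * bracket t :=
    contDiff_levelCutoff.mul contDiff_bracket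
  have hw : ContDiff ℝ 1 fun x => levelCutoff (u x) * bracket (u x) := hψ.comp hu
  have hw0 : ∀ x, 0 ≤ levelCutoff (u x) * bracket (u x) := fun x =>
    mul_nonneg (levelCutoff_nonneg _) (bracket_pos _).le
  have hwc : HasCompactSupport fun x => levelCutoff (u x) * bracket (u x) :=
    HasCompactSupport.intro hS fun x hx => by
      rw [levelCutoff_eq_zero (not_le.1 hx).le, zero_mul]
  have hdc := hu.continuous_fderiv one_ne_zero
  have hNp : 0 ≤ (N : ℝ) / (N - 1) := div_nonneg (by linarith) (by linarith)
  have h := integral_rpow_le_of_norm_fderiv_le hN hw hwc hw0 hS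
    (h := fun x => C * ‖fderiv ℝ u x‖) (by fun_prop) (fun x => by positivity) fun x => by
      have h1 : HasFDerivAt (fun x => levelCutoff (u x) * bracket (u x))
          (deriv (fun t => levelCutoff t * bracket t) (u x) • fderiv ℝ u x) x :=
        ((hψ.differentiable one_ne_zero (u x)).hasDerivAt.comp_hasFDerivAt x
          (hu.differentiable one_ne_zero x).hasFDerivAt)
      rw [h1.fderiv, norm_smul, Real.norm_eq_abs]
      by_cases hx : x ∈ S
      · rw [Set.indicator_of_mem hx]
        exact mul_le_mul_of_nonneg_right (hle _) (norm_nonneg _)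
      · rw [Set.indicator_of_notMem hx, hzero _ (not_le.1 hx)]
        simp
  have hintg : ∀ f : EuclideanSpace ℝ (Fin N) → ℝ, Continuous f → IntegrableOn f S := fun f hf =>
    hf.continuousOn.integrableOn_compact hS
  have hbc : Continuous fun x => bracket (u x) := continuous_bracket.comp hu.continuous
  have hLc : Continuous fun x => (levelCutoff (u x) * bracket (u x)) ^ ((N : ℝ) / (N - 1)) :=
    hw.continuous.rpow_const fun x => Or.inr hNp
  have h1 : ∫ x in S, bracket (u x) ≤
      ∫ x in S, ((levelCutoff (u x) * bracket (u x)) ^ ((N : ℝ) / (N - 1)) + 3) := by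
    refine setIntegral_mono (hintg _ hbc) (hintg _ (hLc.add continuous_const)) fun x => ?_
    by_cases h2 : 2 ≤ |u x|
    · refine le_add_of_le_of_nonneg ?_ (by norm_num)
      simp only
      rw [levelCutoff_eq_one h2, one_mul]
      refine Real.self_le_rpow_of_one_le (one_le_bracket _) ?_
      rw [one_le_div (by linarith)]
      linarith
    · push Not at h2
      refine le_add_of_nonneg_of_le (Real.rpow_nonneg (hw0 x) _)
        (Real.sqrt_le_iff.2 ⟨by norm_num, ?_⟩)
      nlinarith [abs_nonneg (u x), sq_abs (u x)]
  rw [integral_add (hintg _ hLc) (hintg _ continuous_const), setIntegral_const, smul_eq_mul] at h1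
  refine h1.trans (add_le_add (h.trans (mul_le_mul_of_nonneg_left (Real.rpow_le_rpow
    (integral_nonneg fun x => by positivity) ?_ hNp) (by positivity)))
    (mul_le_mul_of_nonneg_right hvol (by norm_num)))
  rw [integral_const_mul]
  exact mul_le_mul_of_nonneg_left hgrad hC

theorem setIntegral_le_of_lintegral_le {X : Type*} [MeasurableSpace X] {μ : Measure X}
    {S : Set X} {f : X → ℝ} (hf : AEStronglyMeasurable f (μ.restrict S)) (h0 : ∀ x, 0 ≤ f x)
    {M : ℝ} (hM : 0 ≤ M) (h : ∫⁻ x, ENNReal.ofReal (f x) ∂μ ≤ ENNReal.ofReal M) :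
    ∫ x in S, f x ∂μ ≤ M := by
  rw [integral_eq_lintegral_of_nonneg_ae (ae_of_all _ h0) hf]
  exact ENNReal.toReal_le_of_le_ofReal hM ((setLIntegral_le_lintegral _ _).trans h)

theorem CondO.exists_le_potential {N : ℕ} {p q a V : EuclideanSpace ℝ (Fin N) → ℝ}
    (hO : CondO N p q a V) :
    ∃ (E : Set (EuclideanSpace ℝ (Fin N))) (κ : ℝ), MeasurableSet E ∧ volume E < ⊤ ∧ 0 < κ ∧
      ∀ᵐ x, x ∉ E → κ ≤ V x := by
  rcases hO.V_alt with ⟨K, hK, -, hvol⟩ | ⟨R, hR, hV⟩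
  · refine ⟨toMeasurable volume {x | V x ≤ K}, K, measurableSet_toMeasurable _ _,
      by rwa [measure_toMeasurable], hK, ae_of_all _ fun x hx => ?_⟩
    by_contra h
    exact hx (subset_toMeasurable _ _ (not_le.1 h).le)
  · have hm : MeasurableSet {x : EuclideanSpace ℝ (Fin N) | R ≤ ‖x‖} :=
      measurableSet_le measurable_const measurable_norm
    refine ⟨Metric.ball 0 R, _, measurableSet_ball, measure_ball_lt_top, hV, ?_⟩
    have h : ∀ᵐ x ∂volume.restrict {x : EuclideanSpace ℝ (Fin N) | R ≤ ‖x‖},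
        essInf V (volume.restrict {x : EuclideanSpace ℝ (Fin N) | R ≤ ‖x‖}) ≤ V x :=
      ae_essInf_le (isBoundedUnder_of_eventually_ge (ae_restrict_of_ae hO.V_nonneg))
    rw [ae_restrict_iff' hm] at h
    filter_upwards [h] with x hx hxE
    exact hx (by simpa using hxE)

theorem norm_gradient {N : ℕ} (u : EuclideanSpace ℝ (Fin N) → ℝ) (x) :
    ‖gradient u x‖ = ‖fderiv ℝ u x‖ := by
  rw [gradient, LinearIsometryEquiv.norm_map]

theorem rpow_div_mul_rpow_le {N a g q s : ℝ} (ha : 0 ≤ a) (hg : 0 < g) (hq1 : 1 < q) (hqs : q ≤ s)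
    (hs : s ≤ N * q / (N - q)) :
    a ^ (s / q) * g ^ s ≤ 1 + (a * g ^ q) ^ (N / (N - q)) := by
  have hq0 : 0 < q := by linarith
  have hy : 0 ≤ a * g ^ q := by positivity
  have h1 : a ^ (s / q) * g ^ s = (a * g ^ q) ^ (s / q) := by
    rw [Real.mul_rpow ha (by positivity), ← Real.rpow_mul hg.le, mul_div_cancel₀ _ hq0.ne']
  rw [h1]
  rcases le_total (a * g ^ q) 1 with h | h
  · exact le_add_of_le_of_nonneg (Real.rpow_le_one hy h (div_nonneg (by linarith) hq0.le))
      (by positivity)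
  · refine le_add_of_nonneg_of_le zero_le_one (Real.rpow_le_rpow_of_exponent_le h ?_)
    rw [div_le_iff₀ hq0]
    refine hs.trans (le_of_eq ?_)
    ring

theorem lintegral_le_of_modular_le {N : ℕ} {p q a V : EuclideanSpace ℝ (Fin N) → ℝ}
    (hO : CondO N p q a V) {r s : EuclideanSpace ℝ (Fin N) → ℝ}
    (hr : ∀ x, p x ≤ r x ∧ r x ≤ N * p x / (N - p x))
    (hs : ∀ x, q x ≤ s x ∧ s x ≤ N * q x / (N - q x)) :
    ∃ C : ℝ, ∀ u : EuclideanSpace ℝ (Fin N) → ℝ, ContDiff ℝ 1 u → HasCompactSupport u →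
      ∫⁻ x, (ENNReal.ofReal (Hfun p q a x ‖gradient u x‖) +
        ENNReal.ofReal (V x * Hfun p q a x |u x|)) ≤ 1 →
      ∫⁻ x, ENNReal.ofReal (|u x| ^ r x + a x ^ (s x / q x) * |u x| ^ s x) ≤
        ENNReal.ofReal C := by
  obtain ⟨Kp, hKp⟩ := hO.lip_p
  obtain ⟨Kq, hKq⟩ := hO.lip_q
  obtain ⟨Ka, hKa⟩ := hO.lip_a
  obtain ⟨p₀, hp₀, hp₀p⟩ := hO.inf_p
  obtain ⟨Q, hQN, hqQ⟩ := hO.sup_q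
  obtain ⟨A, haA⟩ := hO.a_bdd
  have ha0 := hO.a_nonneg
  have hpq := hO.p_lt_q
  have hqN := hO.q_lt_N
  have hp1 : ∀ x, 1 < p x := fun x => hp₀.trans_le (hp₀p x)
  have hq1 : ∀ x, 1 < q x := fun x => (hp1 x).trans (hpq x)
  have hpN : ∀ x, p x < N := fun x => (hpq x).trans (hqN x)
  have hA : 0 ≤ A := (ha0 0).trans (haA 0)
  have hN : 2 ≤ N := by
    have : (1 : ℝ) < N := (hq1 0).trans (hqN 0)
    exact_mod_cast this
  have hN' : (2 : ℝ) ≤ N := by exact_mod_cast hN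
  have hratio : ∀ x, N * q x ≤ (N + 1) * p x := fun x => by
    obtain ⟨c, hc, h⟩ := hO.ratio
    have h1 := (h x).trans hc.le
    have hp0 : 0 < p x := by linarith [hp1 x]
    rw [div_le_iff₀ hp0] at h1
    have := mul_le_mul_of_nonneg_left h1 (by linarith : (0 : ℝ) ≤ N)
    refine this.trans (le_of_eq ?_)
    field_simp
  obtain ⟨E, κ, hE, hEvol, hκ, hVκ⟩ := hO.exists_le_potential
  set M := volume.real E + κ⁻¹ + 1 with hM
  have hM0 : 0 ≤ M := by positivity
  obtain ⟨M₁, hM₁⟩ := integral_bracket_le hN M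
  obtain ⟨M₂, hM₂⟩ := integral_critInt_le hN (LipschitzWith.const (1 : ℝ)) hKp (A := 1)
    (fun _ => zero_le_one) (fun _ => le_rfl) hp₀ hp₀p (fun x => (hpq x).le.trans (hqQ x)) hQN
    (M := max M M₁) (hM0.trans (le_max_left _ _))
  obtain ⟨M₃, hM₃⟩ := integral_critInt_le hN hKa hKq ha0 haA hp₀
    (fun x => (hp₀p x).trans (hpq x).le) hqQ hQN
    (M := max (max M M₁) M₂) (hM0.trans ((le_max_left _ _).trans (le_max_left _ _)))
  set c₀ := (1 + A) ^ ((N : ℝ) / (N - Q)) with hc₀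
  have hc₀0 : 0 ≤ c₀ := by positivity
  refine ⟨(1 + c₀) * M + (M₂ + M₃), fun u hu huc hmod => ?_⟩
  have hS := isCompact_superlevel hu.continuous huc
  set S := {x | 1 ≤ |u x|} with hSdef
  have hintg : ∀ f : EuclideanSpace ℝ (Fin N) → ℝ, Continuous f → IntegrableOn f S := fun f hf =>
    hf.continuousOn.integrableOn_compact hS
  have hdc := hu.continuous_fderiv one_ne_zero
  have hpc := hKp.continuous
  have hqc := hKq.continuous
  have hac := hKa.continuous
  have hbc : Continuous fun x => bracket (u x) := continuous_bracket.comp hu.continuous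
  have hdp : Continuous fun x => ‖fderiv ℝ u x‖ ^ p x :=
    hdc.norm.rpow hpc fun x => Or.inr (one_pos.trans (hp1 x))
  have hdq : Continuous fun x => a x * ‖fderiv ℝ u x‖ ^ q x :=
    hac.mul (hdc.norm.rpow hqc fun x => Or.inr (one_pos.trans (hq1 x)))
  have hZp : Continuous (critInt u (fun _ => 1) p) :=
    continuous_critInt hu.continuous continuous_const hpc hp1 hpN
  have hZq : Continuous (critInt u a q) := continuous_critInt hu.continuous hac hqc hq1 hqN
  have hmp : ∫ x in S, ‖fderiv ℝ u x‖ ^ p x ≤ 1 := by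
    refine setIntegral_le_of_lintegral_le hdp.aestronglyMeasurable (fun x => by positivity)
      zero_le_one (le_trans (lintegral_mono fun x => ?_) (hmod.trans (by simp)))
    refine le_add_of_le_of_nonneg (ENNReal.ofReal_le_ofReal ?_) zero_le
    rw [Hfun, norm_gradient]
    exact le_add_of_nonneg_right (mul_nonneg (ha0 x) (by positivity))
  have hmq : ∫ x in S, a x * ‖fderiv ℝ u x‖ ^ q x ≤ 1 := by
    refine setIntegral_le_of_lintegral_le hdq.aestronglyMeasurable
      (fun x => mul_nonneg (ha0 x) (by positivity))
      zero_le_one (le_trans (lintegral_mono fun x => ?_) (hmod.trans (by simp)))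
    refine le_add_of_le_of_nonneg (ENNReal.ofReal_le_ofReal ?_) zero_le
    rw [Hfun, norm_gradient]
    exact le_add_of_nonneg_left (by positivity)
  have hmin : ∫⁻ x, ENNReal.ofReal (min 1 (|u x| ^ p x)) ≤ ENNReal.ofReal (M - 1) := by
    calc ∫⁻ x, ENNReal.ofReal (min 1 (|u x| ^ p x)) ≤
        ∫⁻ x, (E.indicator 1 x + ENNReal.ofReal κ⁻¹ *
          (ENNReal.ofReal (Hfun p q a x ‖gradient u x‖) +
            ENNReal.ofReal (V x * Hfun p q a x |u x|))) := by
          refine lintegral_mono_ae ?_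
          filter_upwards [hVκ] with x hx
          by_cases hxE : x ∈ E
          · rw [Set.indicator_of_mem hxE]
            refine le_add_of_le_of_nonneg ?_ zero_le
            simp
          · refine le_add_of_nonneg_of_le zero_le ?_
            refine le_trans ?_ (mul_le_mul_right (le_add_of_nonneg_left zero_le) _)
            rw [← ENNReal.ofReal_mul (by positivity)]
            refine ENNReal.ofReal_le_ofReal ((min_le_right _ _).trans ?_)
            have h1 : |u x| ^ p x ≤ Hfun p q a x |u x| :=
              le_add_of_nonneg_right (mul_nonneg (ha0 x) (by positivity))
            have h2 : 0 ≤ Hfun p q a x |u x| := le_trans (by positivity) h1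
            rw [inv_mul_eq_div, le_div_iff₀ hκ]
            nlinarith [hx hxE]
      _ ≤ volume E + ENNReal.ofReal κ⁻¹ * 1 := by
          rw [lintegral_add_left (measurable_one.indicator hE), lintegral_indicator_one hE,
            lintegral_const_mul' _ _ ENNReal.ofReal_ne_top]
          gcongr
      _ = ENNReal.ofReal (M - 1) := by
          rw [hM, add_sub_cancel_right, ENNReal.ofReal_add measureReal_nonneg (by positivity),
            ofReal_measureReal hEvol.ne, mul_one]
  have hSone : ∀ x ∈ S, min 1 (|u x| ^ p x) = 1 := fun x hx =>
    min_eq_left (Real.one_le_rpow hx (by linarith [hp1 x]))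
  have hvol : volume.real S ≤ M - 1 := by
    refine ENNReal.toReal_le_of_le_ofReal (by rw [hM]; simp; positivity) (le_trans ?_ hmin)
    rw [← lintegral_indicator_one hS.measurableSet]
    refine lintegral_mono fun x => ?_
    by_cases hx : x ∈ S
    · rw [Set.indicator_of_mem hx, hSone x hx]
      simp
    · rw [Set.indicator_of_notMem hx]
      exact zero_le
  have hvol' : volume.real S ≤ M := by linarith
  have hM1 : 1 ≤ M := by rw [hM]; have : 0 ≤ volume.real E + κ⁻¹ := by positivity
                         linarith
  have hgrad : ∫ x in S, ‖fderiv ℝ u x‖ ≤ M := by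
    have h1 : ∫ x in S, ‖fderiv ℝ u x‖ ≤ ∫ x in S, (1 + ‖fderiv ℝ u x‖ ^ p x) := by
      refine setIntegral_mono (hintg _ hdc.norm) (hintg _ (continuous_const.add hdp)) fun x => ?_
      rcases le_total ‖fderiv ℝ u x‖ 1 with h | h
      · exact le_add_of_le_of_nonneg h (by positivity)
      · exact le_add_of_nonneg_of_le zero_le_one (Real.self_le_rpow_of_one_le h (hp1 x).le)
    rw [integral_add (hintg _ continuous_const) (hintg _ hdp), setIntegral_const, smul_eq_mul] at h1
    linarith
  have h1 := hM₁ u hu huc hvol' hgrad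
  have h2 := hM₂ u hu huc (hvol'.trans (le_max_left _ _))
    (by simpa only [one_mul] using hmp.trans (hM1.trans (le_max_left _ _)))
    (h1.trans (le_max_right _ _)) (Or.inl fun _ => rfl)
  have hgp : ∫ x in S, bracket (u x) ^ (N * q x / (N - q x + 1)) ≤ M₂ := by
    refine le_trans (setIntegral_mono (hintg _ ?_) (hintg _ hZp) fun x => ?_) h2
    · exact hbc.rpow ((continuous_const.mul hqc).div
        ((continuous_const.sub hqc).add continuous_const)
        fun x => by linarith [hqN x]) fun x => Or.inl (bracket_pos _).ne'
    · simp only [critInt, one_mul]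
      rw [← Real.rpow_mul (bracket_pos _).le]
      refine Real.rpow_le_rpow_of_exponent_le (one_le_bracket _) ?_
      rw [← mul_div_assoc, div_le_div_iff₀ (by linarith [hqN x]) (by linarith [hpN x])]
      nlinarith [hratio x]
  have h3 := hM₃ u hu huc (hvol'.trans ((le_max_left _ _).trans (le_max_left _ _)))
    (hmq.trans (hM1.trans ((le_max_left _ _).trans (le_max_left _ _))))
    (h1.trans ((le_max_right _ _).trans (le_max_left _ _)))
    (Or.inr (hgp.trans (le_max_right _ _)))
  have hpt : ∀ x, ENNReal.ofReal (|u x| ^ r x + a x ^ (s x / q x) * |u x| ^ s x) ≤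
      ENNReal.ofReal (1 + c₀) * ENNReal.ofReal (min 1 (|u x| ^ p x)) +
        S.indicator (fun x => ENNReal.ofReal (critInt u (fun _ => 1) p x + critInt u a q x)) x := by
    intro x
    have hZp0 : 0 ≤ critInt u (fun _ => 1) p x := critInt_nonneg zero_le_one
    have hZq0 : 0 ≤ critInt u a q x := critInt_nonneg (ha0 x)
    have hq0 : 0 < q x := by linarith [hq1 x]
    by_cases hx : x ∈ S
    · rw [hSone x hx, Set.indicator_of_mem hx, ← ENNReal.ofReal_mul (by positivity),
        ← ENNReal.ofReal_add (by positivity) (by positivity)]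
      refine ENNReal.ofReal_le_ofReal ?_
      have hu1 : 1 ≤ |u x| := hx
      have e1 : |u x| ^ r x ≤ critInt u (fun _ => 1) p x := by
        rw [critInt, one_mul, ← Real.rpow_mul (bracket_pos _).le]
        refine (Real.rpow_le_rpow (abs_nonneg _) (abs_le_bracket _)
          (by linarith [hp1 x, hr x])).trans
          (Real.rpow_le_rpow_of_exponent_le (one_le_bracket _) ((hr x).2.trans (le_of_eq ?_)))
        ring
      have e2 : a x ^ (s x / q x) * |u x| ^ s x ≤ 1 + critInt u a q x := by
        refine (mul_le_mul_of_nonneg_left (Real.rpow_le_rpow (abs_nonneg _) (abs_le_bracket _)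
          (by linarith [hs x])) (Real.rpow_nonneg (ha0 x) _)).trans
          (rpow_div_mul_rpow_le (ha0 x) (bracket_pos _) (hq1 x) (hs x).1 (hs x).2)
      linarith
    · rw [Set.indicator_of_notMem hx, add_zero, ← ENNReal.ofReal_mul (by positivity)]
      refine ENNReal.ofReal_le_ofReal ?_
      have hu1 : |u x| ≤ 1 := (not_le.1 hx).le
      have hp0 : 0 ≤ p x := by linarith [hp1 x]
      rw [min_eq_right (Real.rpow_le_one (abs_nonneg _) hu1 hp0), add_mul, one_mul]
      refine add_le_add (Real.rpow_le_rpow_of_exponent_ge' (abs_nonneg _) hu1 hp0 (hr x).1)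
        (mul_le_mul ?_ (Real.rpow_le_rpow_of_exponent_ge' (abs_nonneg _) hu1 hp0
          ((hpq x).le.trans (hs x).1)) (by positivity) hc₀0)
      have hsq : 0 ≤ s x / q x := div_nonneg (by linarith [hs x]) hq0.le
      refine (Real.rpow_le_rpow (ha0 x) (by linarith [haA x] : a x ≤ 1 + A) hsq).trans
        (Real.rpow_le_rpow_of_exponent_le (by linarith) ?_)
      rw [div_le_iff₀ hq0]
      refine (hs x).2.trans ?_
      rw [mul_div_right_comm]
      refine mul_le_mul_of_nonneg_right (div_le_div_of_nonneg_left (by linarith)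
        (by linarith) (by linarith [hqQ x])) hq0.le
  have hM₂0 : 0 ≤ M₂ := (integral_nonneg fun x => critInt_nonneg zero_le_one).trans h2
  have hM₃0 : 0 ≤ M₃ := (integral_nonneg fun x => critInt_nonneg (ha0 x)).trans h3
  have hZ : Continuous fun x => critInt u (fun _ => 1) p x + critInt u a q x := hZp.add hZq
  refine (lintegral_mono hpt).trans ?_
  rw [lintegral_add_right _ (hZ.measurable.ennreal_ofReal.indicator hS.measurableSet),
    lintegral_const_mul' _ _ ENNReal.ofReal_ne_top, lintegral_indicator hS.measurableSet,
    ENNReal.ofReal_add (p := (1 + c₀) * M) (by positivity) (by positivity),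
    ENNReal.ofReal_mul (by positivity)]
  refine add_le_add (mul_le_mul_right (hmin.trans (ENNReal.ofReal_le_ofReal (by linarith))) _) ?_
  rw [← ofReal_integral_eq_lintegral_ofReal (hintg _ hZ)
    (ae_of_all _ fun x => add_nonneg (critInt_nonneg zero_le_one) (critInt_nonneg (ha0 x)))]
  refine ENNReal.ofReal_le_ofReal ?_
  rw [integral_add (hintg _ hZp) (hintg _ hZq)]
  exact add_le_add h2 h3

theorem div_rpow_le_div {t τ e : ℝ} (ht : 0 ≤ t) (hτ : 1 ≤ τ) (he : 1 ≤ e) :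
    (t / τ) ^ e ≤ t ^ e / τ := by
  rw [Real.div_rpow ht (by linarith)]
  exact div_le_div_of_nonneg_left (by positivity) (by linarith) (Real.self_le_rpow_of_one_le hτ he)

theorem Hfun_div_le {N : ℕ} {p q a : EuclideanSpace ℝ (Fin N) → ℝ} {x} (ha : 0 ≤ a x)
    (hp : 1 ≤ p x) (hq : 1 ≤ q x) {t τ : ℝ} (ht : 0 ≤ t) (hτ : 1 ≤ τ) :
    Hfun p q a x (t / τ) ≤ τ⁻¹ * Hfun p q a x t := by
  have h1 := div_rpow_le_div ht hτ hp
  have h2 := mul_le_mul_of_nonneg_left (div_rpow_le_div ht hτ hq) ha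
  rw [Hfun, Hfun]
  linear_combination h1 + h2

theorem CondO.modular_lt_top {N : ℕ} {p q a V : EuclideanSpace ℝ (Fin N) → ℝ}
    (hO : CondO N p q a V) {u : EuclideanSpace ℝ (Fin N) → ℝ} (hu : ContDiff ℝ 1 u)
    (huc : HasCompactSupport u) :
    ∫⁻ x, (ENNReal.ofReal (Hfun p q a x ‖gradient u x‖) +
      ENNReal.ofReal (V x * Hfun p q a x |u x|)) < ⊤ := by
  obtain ⟨Kp, hKp⟩ := hO.lip_p
  obtain ⟨Kq, hKq⟩ := hO.lip_q
  obtain ⟨Ka, hKa⟩ := hO.lip_a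
  obtain ⟨p₀, hp₀, hp₀p⟩ := hO.inf_p
  have hp0 : ∀ x, 0 < p x := fun x => by linarith [hp₀p x]
  have hq0 : ∀ x, 0 < q x := fun x => (hp0 x).trans (hO.p_lt_q x)
  have hcont : ∀ f : EuclideanSpace ℝ (Fin N) → ℝ, Continuous f →
      Continuous fun x => Hfun p q a x (f x) := fun f hf =>
    (hf.rpow hKp.continuous fun x => Or.inr (hp0 x)).add
      (hKa.continuous.mul (hf.rpow hKq.continuous fun x => Or.inr (hq0 x)))
  have hsupp : ∀ f : EuclideanSpace ℝ (Fin N) → ℝ, HasCompactSupport f →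
      HasCompactSupport fun x => Hfun p q a x (f x) := fun f hf =>
    hf.mono fun x hx h => hx (by
      simp only [Hfun, h, Real.zero_rpow (hp0 x).ne', Real.zero_rpow (hq0 x).ne', mul_zero,
        add_zero])
  have h1 : Integrable fun x => Hfun p q a x ‖gradient u x‖ := by
    simp only [norm_gradient]
    exact (hcont _ (hu.continuous_fderiv one_ne_zero).norm).integrable_of_hasCompactSupport
      (hsupp _ (huc.fderiv ℝ).norm)
  have h2 : Integrable fun x => V x * Hfun p q a x |u x| :=
    hO.V_loc.integrable_smul_right_of_hasCompactSupport (hcont _ hu.continuous.abs)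
      (hsupp _ huc.norm)
  rw [lintegral_add_left' h1.aestronglyMeasurable.aemeasurable.ennreal_ofReal]
  exact ENNReal.add_lt_top.2 ⟨h1.lintegral_lt_top, h2.lintegral_lt_top⟩

theorem CondO.exists_modular_div_le_one {N : ℕ} {p q a V : EuclideanSpace ℝ (Fin N) → ℝ}
    (hO : CondO N p q a V) {u : EuclideanSpace ℝ (Fin N) → ℝ} (hu : ContDiff ℝ 1 u)
    (huc : HasCompactSupport u) :
    ∃ τ : ℝ, 0 < τ ∧ ∫⁻ x, (ENNReal.ofReal (Hfun p q a x (‖gradient u x‖ / τ)) +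
      ENNReal.ofReal (V x * Hfun p q a x (|u x| / τ))) ≤ 1 := by
  have hL := hO.modular_lt_top hu huc
  set L := ∫⁻ x, (ENNReal.ofReal (Hfun p q a x ‖gradient u x‖) +
      ENNReal.ofReal (V x * Hfun p q a x |u x|)) with hLdef
  obtain ⟨p₀, hp₀, hp₀p⟩ := hO.inf_p
  have hp1 : ∀ x, 1 ≤ p x := fun x => by linarith [hp₀p x]
  have hq1 : ∀ x, 1 ≤ q x := fun x => (hp1 x).trans (hO.p_lt_q x).le
  set τ := max 1 L.toReal with hτ
  have hτ1 : 1 ≤ τ := le_max_left _ _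
  have hτ0 : 0 < τ := by linarith
  refine ⟨τ, hτ0, ?_⟩
  calc ∫⁻ x, (ENNReal.ofReal (Hfun p q a x (‖gradient u x‖ / τ)) +
      ENNReal.ofReal (V x * Hfun p q a x (|u x| / τ)))
      ≤ ∫⁻ x, ENNReal.ofReal τ⁻¹ * (ENNReal.ofReal (Hfun p q a x ‖gradient u x‖) +
        ENNReal.ofReal (V x * Hfun p q a x |u x|)) := by
        refine lintegral_mono_ae ?_
        filter_upwards [hO.V_nonneg] with x hV
        rw [mul_add, ← ENNReal.ofReal_mul (by positivity), ← ENNReal.ofReal_mul (by positivity)]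
        refine add_le_add (ENNReal.ofReal_le_ofReal
          (Hfun_div_le (hO.a_nonneg x) (hp1 x) (hq1 x) (norm_nonneg _) hτ1))
          (ENNReal.ofReal_le_ofReal ?_)
        rw [mul_left_comm]
        exact mul_le_mul_of_nonneg_left
          (Hfun_div_le (hO.a_nonneg x) (hp1 x) (hq1 x) (abs_nonneg _) hτ1) hV
    _ = ENNReal.ofReal τ⁻¹ * L := lintegral_const_mul' _ _ ENNReal.ofReal_ne_top
    _ ≤ ENNReal.ofReal τ⁻¹ * ENNReal.ofReal τ := by
        gcongr
        rw [← ENNReal.ofReal_toReal hL.ne]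
        exact ENNReal.ofReal_le_ofReal (le_max_right _ _)
    _ = 1 := by
        rw [← ENNReal.ofReal_mul (by positivity), inv_mul_cancel₀ hτ0.ne', ENNReal.ofReal_one]

/-- **Embedding of `X_V` into Musielak–Orlicz Lebesgue spaces under condition (O).**
With `p ≤ r ≤ p*`, `q ≤ s ≤ q*` and `F(x,t) = t^{r(x)} + a(x)^{s(x)/q(x)} t^{s(x)}`,
there is `C > 0` such that `‖u‖_{L^F(ℝ^N)} ≤ C ‖u‖` for every `u ∈ C_c^∞(ℝ^N)`. -/
theorem stmt18 {N : ℕ} (p q a V : EuclideanSpace ℝ (Fin N) → ℝ) (hO : CondO N p q a V)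
    (r s : EuclideanSpace ℝ (Fin N) → ℝ)
    (hrcont : Continuous r) (hscont : Continuous s)
    (hrbdd : ∃ C : ℝ, ∀ x, r x ≤ C) (hsbdd : ∃ C : ℝ, ∀ x, s x ≤ C)
    (hr : ∀ x, p x ≤ r x ∧ r x ≤ N * p x / (N - p x))
    (hs : ∀ x, q x ≤ s x ∧ s x ≤ N * q x / (N - q x)) :
    ∃ C > (0 : ℝ), ∀ u : EuclideanSpace ℝ (Fin N) → ℝ,
      ContDiff ℝ (⊤ : ℕ∞) u → HasCompactSupport u →
      luxNormOn (fun x t => t ^ r x + a x ^ (s x / q x) * t ^ s x) Set.univ u ≤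
        C * VNorm p q a V u := by
  obtain ⟨C₀, hC₀⟩ := lintegral_le_of_modular_le hO hr hs
  obtain ⟨p₀, hp₀, hp₀p⟩ := hO.inf_p
  have hr1 : ∀ x, 1 ≤ r x := fun x => by linarith [hp₀p x, hr x]
  have hs1 : ∀ x, 1 ≤ s x := fun x => by linarith [hp₀p x, hO.p_lt_q x, hs x]
  set C := max 1 C₀ with hC
  have hC1 : 1 ≤ C := le_max_left _ _
  have hC0 : 0 < C := by linarith
  refine ⟨C, hC0, fun u hu' huc => ?_⟩
  have hu : ContDiff ℝ 1 u := hu'.of_le (by exact_mod_cast le_top)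
  rw [mul_comm, ← div_le_iff₀ hC0]
  refine le_csInf (hO.exists_modular_div_le_one hu huc) fun τ ⟨hτ, hmod⟩ => ?_
  rw [div_le_iff₀ hC0]
  refine csInf_le ⟨0, fun t ht => ht.1.le⟩ ⟨by positivity, ?_⟩
  rw [setLIntegral_univ]
  have habs : ∀ x, |τ⁻¹ * u x| = |u x| / τ := fun x => by
    rw [abs_mul, abs_of_pos (inv_pos.2 hτ), inv_mul_eq_div]
  have hgrad : ∀ x, ‖gradient (fun x => τ⁻¹ * u x) x‖ = ‖gradient u x‖ / τ := fun x => by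
    rw [norm_gradient, norm_gradient, fderiv_const_mul (hu.differentiable one_ne_zero x),
      norm_smul, Real.norm_of_nonneg (inv_pos.2 hτ).le, inv_mul_eq_div]
  have h := hC₀ (fun x => τ⁻¹ * u x) (contDiff_const.mul hu) huc.mul_left
    (by simpa only [habs, hgrad] using hmod)
  simp only [habs] at h
  calc ∫⁻ x, ENNReal.ofReal ((|u x| / (τ * C)) ^ r x +
        a x ^ (s x / q x) * (|u x| / (τ * C)) ^ s x)
      ≤ ∫⁻ x, ENNReal.ofReal C⁻¹ * ENNReal.ofReal ((|u x| / τ) ^ r x +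
        a x ^ (s x / q x) * (|u x| / τ) ^ s x) := by
        refine lintegral_mono fun x => ?_
        rw [← ENNReal.ofReal_mul (by positivity), ← div_div]
        refine ENNReal.ofReal_le_ofReal ?_
        have ht : 0 ≤ |u x| / τ := by positivity
        have h1 := div_rpow_le_div ht hC1 (hr1 x)
        have h2 := mul_le_mul_of_nonneg_left (div_rpow_le_div ht hC1 (hs1 x))
          (Real.rpow_nonneg (hO.a_nonneg x) (s x / q x))
        linear_combination h1 + h2
    _ = ENNReal.ofReal C⁻¹ * ∫⁻ x, ENNReal.ofReal ((|u x| / τ) ^ r x +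
        a x ^ (s x / q x) * (|u x| / τ) ^ s x) := lintegral_const_mul' _ _ ENNReal.ofReal_ne_top
    _ ≤ ENNReal.ofReal C⁻¹ * ENNReal.ofReal C := by
        gcongr
        exact h.trans (ENNReal.ofReal_le_ofReal (le_max_right _ _))
    _ = 1 := by
        rw [← ENNReal.ofReal_mul (by positivity), inv_mul_cancel₀ hC0.ne', ENNReal.ofReal_one]
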